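/- arXiv:1012.0826 — 2 statements merged into one kernel-verified Lean document; each statement's English description precedes it below -/
import Mathlib

section
/- Under assumptions (B1), (B2), (MT1), (MT2) and (GT), the family of recentered maxima distributions {F_n(· − Med(F_n))}_{n≥0} is tight: for every ε > 0 there exists K > 0 such that for all n ≥ 0, F_n(Med(F_n) + K) − F_n(Med(F_n) − K) ≥ 1 − ε. -/
open MeasureTheory Set Filter

lemma aux_diff {ι : Type*} (s : Finset ι) (a b : ι → ℝ) (ha : ∀ i, 0 ≤ a i) (hab : ∀ i, a i ≤ b i)
    (hb : ∀ i, b i ≤ 1) :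
    (∑ i ∈ s, (b i - a i)) * ∏ i ∈ s, (1 - b i) ≤ ∏ i ∈ s, (1 - a i) - ∏ i ∈ s, (1 - b i) := by
  classical
  induction s using Finset.induction_on with
  | empty => simp
  | insert j s hj ih =>
    rw [Finset.sum_insert hj, Finset.prod_insert hj, Finset.prod_insert hj]
    have hP : 0 ≤ ∏ i ∈ s, (1 - b i) := Finset.prod_nonneg fun i _ => by linarith [hb i]
    have hD : 0 ≤ ∑ i ∈ s, (b i - a i) := Finset.sum_nonneg fun i _ => by linarith [hab i]
    set P := ∏ i ∈ s, (1 - b i)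
    set A := ∏ i ∈ s, (1 - a i)
    set D := ∑ i ∈ s, (b i - a i)
    have h1 : (1 - a j) * (P + D * P) ≤ (1 - a j) * A :=
      mul_le_mul_of_nonneg_left (by linarith) (by linarith [hab j, hb j])
    have h2 : 0 ≤ (b j - a j) * (b j * P) :=
      mul_nonneg (by linarith [hab j]) (mul_nonneg (by linarith [ha j, hab j]) hP)
    have h3 : 0 ≤ (b j - a j) * (D * P) :=
      mul_nonneg (by linarith [hab j]) (mul_nonneg hD hP)
    nlinarith

lemma aux_one_sub {ι : Type*} (s : Finset ι) (b : ι → ℝ) (h0 : ∀ i, 0 ≤ b i) (hb : ∀ i, b i ≤ 1) :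
    1 - ∑ i ∈ s, b i ≤ ∏ i ∈ s, (1 - b i) := by
  classical
  induction s using Finset.induction_on with
  | empty => simp
  | insert j s hj ih =>
    rw [Finset.sum_insert hj, Finset.prod_insert hj]
    have hD : 0 ≤ ∑ i ∈ s, b i := Finset.sum_nonneg fun i _ => h0 i
    have := mul_le_mul_of_nonneg_left ih (by linarith [hb j] : (0:ℝ) ≤ 1 - b j)
    nlinarith [mul_nonneg (h0 j) hD]

lemma aux_sq {k : ℕ} (a : Fin k → ℝ) (K : ℝ) (hk : (k : ℝ) ≤ K) :
    (∑ i, a i) ^ 2 ≤ K * ∑ i, a i ^ 2 := by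
  have := sq_sum_le_card_mul_sum_sq (s := (Finset.univ : Finset (Fin k))) (f := a)
  simp at this
  have h2 : 0 ≤ ∑ i, a i ^ 2 := Finset.sum_nonneg fun i _ => sq_nonneg _
  nlinarith [mul_le_mul_of_nonneg_right hk h2]

lemma R_second {k : ℕ} (a : Fin k → ℝ) (K : ℝ) (hk : (k : ℝ) ≤ K) (ha : ∀ i, 0 ≤ a i)
    (ha1 : ∀ i, a i ≤ 1) :
    ∑ i, (a i - K * a i ^ 2) ≤ 1 - ∏ i, (1 - a i) := by
  have h := aux_diff Finset.univ (fun _ => 0) a (fun _ => le_rfl) ha ha1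
  simp at h
  have h1 := aux_one_sub Finset.univ a ha ha1
  have h2 := aux_sq a K hk
  have h3 : 0 ≤ ∑ i, a i := Finset.sum_nonneg fun i _ => ha i
  rw [Finset.sum_sub_distrib, ← Finset.mul_sum]
  nlinarith [mul_le_mul_of_nonneg_left h1 h3]

lemma R_first {k : ℕ} (a : Fin k → ℝ) (K : ℝ) (hK : 0 < K) (hk : (k : ℝ) ≤ K) (ha : ∀ i, 0 ≤ a i)
    (ha1 : ∀ i, a i ≤ 1) :
    ∑ i, (a i / K) ≤ 1 - ∏ i, (1 - a i) := by
  have hR : ∀ i, a i ≤ 1 - ∏ i, (1 - a i) := by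
    intro i
    have : ∏ i, (1 - a i) ≤ 1 - a i := by
      rw [← Finset.mul_prod_erase _ _ (Finset.mem_univ i)]
      exact mul_le_of_le_one_right (by linarith [ha1 i])
        (Finset.prod_le_one (fun j _ => by linarith [ha1 j]) (fun j _ => by linarith [ha j]))
    linarith
  have h0 : 0 ≤ 1 - ∏ i, (1 - a i) := by
    have := Finset.prod_le_one (s := Finset.univ) (f := fun i => 1 - a i)
      (fun j _ => by linarith [ha1 j]) (fun j _ => by linarith [ha j])
    linarith
  rw [← Finset.sum_div, div_le_iff₀ hK]
  calc ∑ i, a i ≤ ∑ i : Fin k, (1 - ∏ i, (1 - a i)) := Finset.sum_le_sum fun i _ => hR i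
    _ = k * (1 - ∏ i, (1 - a i)) := by rw [Finset.sum_const]; simp
    _ ≤ (1 - ∏ i, (1 - a i)) * K := by nlinarith

lemma aux_cross (K ε ω S Q E : ℝ) (hK : 1 ≤ K) (hε : 0 ≤ ε) (hε1 : ε ≤ 1) (hω : 0 < ω)
    (hωK : 4 * ω * K ≤ 1) (hE0 : 0 ≤ E) (hS0 : 0 ≤ S) (hEK : E ≤ K) (hSQ : S ^ 2 ≤ K * Q) :
    (ε * S + ω * E) * (2 * S + ω * E) ≤ (2 * ε + 9 * ω * K) * K * Q + ω * E / 2 := by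
  have e1 : ω ^ 2 * E ^ 2 ≤ ω * E / 4 := by
    have h1 : 4 * ω * E ≤ 4 * ω * K := by gcongr
    have : (ω * E) * (4 * ω * E) ≤ (ω * E) * 1 :=
      mul_le_mul_of_nonneg_left (h1.trans hωK) (by positivity)
    nlinarith
  have e2 : 3 * ω * (S * E) ≤ ω * E / 4 + 9 * ω * K * S ^ 2 := by
    have h1 : 12 * K * (S * E) ≤ E ^ 2 + 36 * K ^ 2 * S ^ 2 := by
      nlinarith [sq_nonneg (E - 6 * K * S)]
    have h' : K * (12 * (S * E)) ≤ K * (E + 36 * K * S ^ 2) := by nlinarith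
    have h'' : 12 * (S * E) ≤ E + 36 * K * S ^ 2 := le_of_mul_le_mul_left h' (by linarith)
    nlinarith
  have e3 : (ε * S + ω * E) * (2 * S + ω * E) ≤ 2 * ε * S ^ 2 + 3 * ω * (S * E) + ω ^ 2 * E ^ 2 := by
    have : ε * (ω * (S * E)) ≤ 1 * (ω * (S * E)) := mul_le_mul_of_nonneg_right hε1 (by positivity)
    nlinarith
  have e4 : (2 * ε + 9 * ω * K) * S ^ 2 ≤ (2 * ε + 9 * ω * K) * (K * Q) :=
    mul_le_mul_of_nonneg_left hSQ (by positivity)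
  linarith

lemma R_lower {k : ℕ} (a b : Fin k → ℝ) (K : ℝ) (hk : (k : ℝ) ≤ K) (ha : ∀ i, 0 ≤ a i)
    (hab : ∀ i, a i ≤ b i) (hb1 : ∀ i, b i ≤ 1) (ε ω : ℝ) (hε : 0 ≤ ε) (hε1 : ε ≤ 1)
    (hω : 0 < ω) (hω1 : ω ≤ 1) (hωK : 4 * ω * K ≤ 1) (hK : 1 ≤ K)
    (hb : ∀ i, (1 + ε) * a i - a i ^ 2 ≤ b i) :
    ∑ i, ((ω / 2) * (b i - max (a i) ((1 + ε) * a i - a i ^ 2))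
      - (1 + (2 * ε + 9 * ω * K) * K) * a i ^ 2)
      ≤ (1 - ∏ i, (1 - b i)) - (1 + ε) * (1 - ∏ i, (1 - a i)) := by
  set φ : Fin k → ℝ := fun i => max (a i) ((1 + ε) * a i - a i ^ 2) with hφ
  have hφa : ∀ i, a i ≤ φ i := fun i => le_max_left _ _
  have hφ2 : ∀ i, (1 + ε) * a i - a i ^ 2 ≤ φ i := fun i => le_max_right _ _
  have hφb : ∀ i, φ i ≤ b i := fun i => max_le (hab i) (hb i)
  have hφ3 : ∀ i, φ i ≤ (1 + ε) * a i := fun i =>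
    max_le (by nlinarith [ha i]) (by nlinarith [sq_nonneg (a i)])
  set c : Fin k → ℝ := fun i => φ i + ω * (b i - φ i) with hc
  have hcb : ∀ i, c i ≤ b i := fun i => by
    simp only [hc]; nlinarith [hφb i]
  have hcφ : ∀ i, φ i ≤ c i := fun i => by
    simp only [hc]; nlinarith [hφb i]
  have hc0 : ∀ i, 0 ≤ c i := fun i => (ha i).trans ((hφa i).trans (hcφ i))
  have hca : ∀ i, a i ≤ c i := fun i => (hφa i).trans (hcφ i)
  have hc1 : ∀ i, c i ≤ 1 := fun i => (hcb i).trans (hb1 i)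
  have h1 : ∏ i, (1 - b i) ≤ ∏ i, (1 - c i) :=
    Finset.prod_le_prod (fun i _ => by linarith [hb1 i]) (fun i _ => by linarith [hcb i])
  have h2 := aux_diff Finset.univ a c ha hca hc1
  have h3 := aux_one_sub Finset.univ c hc0 hc1
  have h4 := aux_one_sub Finset.univ a ha (fun i => (hab i).trans (hb1 i))
  have hD0 : 0 ≤ ∑ i, (c i - a i) := Finset.sum_nonneg fun i _ => by linarith [hca i]
  have h5 := mul_le_mul_of_nonneg_left h3 hD0
  set S := ∑ i, a i with hS
  set Q := ∑ i, a i ^ 2 with hQ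
  set E := ∑ i, (b i - φ i) with hE
  have hE0 : 0 ≤ E := Finset.sum_nonneg fun i _ => by linarith [hφb i]
  have hS0 : 0 ≤ S := Finset.sum_nonneg fun i _ => ha i
  have hEK : E ≤ K := by
    calc E ≤ ∑ i : Fin k, (1:ℝ) := Finset.sum_le_sum fun i _ => by linarith [hb1 i, hφa i, ha i]
      _ = k := by simp
      _ ≤ K := hk
  have hSQ : S ^ 2 ≤ K * Q := aux_sq a K hk
  have hDl : ε * S - Q + ω * E ≤ ∑ i, (c i - a i) := by
    rw [hS, hQ, hE, Finset.mul_sum, Finset.mul_sum, ← Finset.sum_sub_distrib, ← Finset.sum_add_distrib]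
    exact Finset.sum_le_sum fun i _ => by simp only [hc]; linarith [hφ2 i]
  have hDu : ∑ i, (c i - a i) ≤ ε * S + ω * E := by
    rw [hS, hE, Finset.mul_sum, Finset.mul_sum, ← Finset.sum_add_distrib]
    exact Finset.sum_le_sum fun i _ => by simp only [hc]; linarith [hφ3 i]
  have hcu : ∑ i, c i ≤ 2 * S + ω * E := by
    rw [hS, hE, Finset.mul_sum, Finset.mul_sum, ← Finset.sum_add_distrib]
    exact Finset.sum_le_sum fun i _ => by simp only [hc]; nlinarith [hφ3 i, ha i]
  have hcs0 : 0 ≤ ∑ i, c i := Finset.sum_nonneg fun i _ => hc0 i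
  have hcross : (∑ i, (c i - a i)) * ∑ i, c i ≤ (ε * S + ω * E) * (2 * S + ω * E) :=
    mul_le_mul hDu hcu hcs0 (by positivity)
  have hlhs : ∑ i, ((ω / 2) * (b i - max (a i) ((1 + ε) * a i - a i ^ 2))
      - (1 + (2 * ε + 9 * ω * K) * K) * a i ^ 2) = ω / 2 * E - (1 + (2 * ε + 9 * ω * K) * K) * Q := by
    rw [hQ, hE, Finset.mul_sum, Finset.mul_sum, ← Finset.sum_sub_distrib]
  rw [hlhs]
  have e5 : ε * (1 - ∏ i, (1 - a i)) ≤ ε * S := mul_le_mul_of_nonneg_left (by linarith) hε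
  have e6 := aux_cross K ε ω S Q E hK hε hε1 hω hωK hE0 hS0 hEK hSQ
  linarith

set_option maxHeartbeats 1000000 in
lemma arith_final (k m1 ϑ ω η L s0 ε : ℝ) (hk : 1 ≤ k) (hϑ : 0 < ϑ) (hϑ1 : ϑ ≤ 1/40)
    (hm : 1 + 20 * ϑ ≤ m1) (hω : 0 < ω) (hη : 0 ≤ η) (hL : 0 < L) (hLϑ : 16 / L ≤ ϑ)
    (hτ : (2 * ε + 9 * ω * k) * k ≤ ϑ) (hε : 0 ≤ ε) (hεϑ : ε ≤ ϑ) (Γ : ℝ)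
    (hΓ : Γ = 2 * k + 4 * k / ω) (hη1 : η ≤ 1) (hηΓ : k * η * Γ ^ 2 ≤ ϑ)
    (hs0 : 0 < s0) (hsm : 2 * k * (Γ * k * s0 + k * Γ ^ 2 * s0 + 2 * Γ / L) ≤ ϑ)
    (hEs : 4 * (k * s0 + 2 / L) ≤ ω / 2)
    (s I Ib X E H : ℝ) (hs : 0 ≤ s) (hss : s ≤ s0) (hIb0 : 0 ≤ Ib) (hIb : Ib ≤ I) (hI : I ≤ k * s)
    (hX0 : 0 ≤ X) (hXI : X ≤ I) (hIs : I ≤ s + k * X) (hE0 : 0 ≤ E) (hH0 : 0 ≤ H)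
    (hX : X ≤ H * Ib + k * η * H ^ 2 + (16 * X + 2 * E) / L)
    (hH : H * m1 ≤ (1 + ε) * Ib + E) :
    - s ^ 2 ≤ ω / 2 * E - (1 + (2 * ε + 9 * ω * k) * k) * X := by
  set τ := (2 * ε + 9 * ω * k) * k with hτd
  have hτ0 : 0 ≤ τ := by positivity
  by_cases hbig : 2 * (1 + τ) * k * s / ω ≤ E
  · rw [div_le_iff₀ hω] at hbig
    nlinarith [mul_le_mul_of_nonneg_left (hXI.trans hI) (by linarith : 0 ≤ 1 + τ), sq_nonneg s]
  push Not at hbig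
  have hEb : E ≤ 4 * k / ω * s := by
    refine hbig.le.trans ?_
    rw [div_mul_eq_mul_div]
    gcongr
    nlinarith [mul_nonneg (by linarith : 0 ≤ k) hs]
  have hΓ0 : 0 ≤ 4 * k / ω := by positivity
  have hΓp : 0 ≤ Γ := by rw [hΓ]; positivity
  have hEΓ : E ≤ Γ * s := by rw [hΓ]; nlinarith [mul_nonneg (by linarith : 0 ≤ k) hs]
  have hHΓ : H ≤ Γ * s := by
    have : H ≤ H * m1 := by nlinarith
    rw [hΓ]; nlinarith
  have hIbk : Ib ≤ k * s := hIb.trans hI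
  have hi : 0 < 1 / L := by positivity
  set i := 1 / L with hid
  have hL1 : ∀ z, z / L = z * i := fun z => by rw [hid]; ring
  rw [hL1] at hX hLϑ hsm hEs
  have hHI1 : H * Ib ≤ (Γ * s) * (k * s) := mul_le_mul hHΓ hIbk hIb0 (by positivity)
  have hH2 : H ^ 2 ≤ Γ ^ 2 * s ^ 2 := by
    rw [← mul_pow]; exact pow_le_pow_left₀ hH0 hHΓ 2
  have hss2 : s ^ 2 ≤ s0 * s := by rw [sq]; gcongr
  have hkη : k * η * H ^ 2 ≤ ϑ * s ^ 2 := by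
    calc k * η * H ^ 2 ≤ k * η * (Γ ^ 2 * s ^ 2) := by gcongr
      _ = (k * η * Γ ^ 2) * s ^ 2 := by ring
      _ ≤ _ := by gcongr
  have hkη' : k * η * H ^ 2 ≤ k * Γ ^ 2 * s0 * s := by
    calc k * η * H ^ 2 ≤ k * 1 * (Γ ^ 2 * (s0 * s)) := by gcongr; exact hH2.trans (by gcongr)
      _ = _ := by ring
  have hXc : X ≤ 2 * (Γ * k * s0 + k * Γ ^ 2 * s0 + 2 * Γ * i) * s := by
    have a1 : 16 * X * i ≤ X / 2 := by
      have := mul_le_mul_of_nonneg_right (hLϑ.trans (hϑ1.trans (by norm_num : (1:ℝ)/40 ≤ 1/2))) hX0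
      linarith
    have a2 : 2 * E * i ≤ 2 * (Γ * s) * i := by gcongr
    have a3 : H * Ib ≤ Γ * k * s0 * s := by
      calc _ ≤ _ := hHI1
        _ = Γ * k * (s ^ 2) := by ring
        _ ≤ Γ * k * (s0 * s) := by gcongr
        _ = _ := by ring
    linarith
  have hkX : k * X ≤ ϑ * s := by
    calc k * X ≤ k * (2 * (Γ * k * s0 + k * Γ ^ 2 * s0 + 2 * Γ * i) * s) := by gcongr
      _ = (2 * k * (Γ * k * s0 + k * Γ ^ 2 * s0 + 2 * Γ * i)) * s := by ring
      _ ≤ ϑ * s := by gcongr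
  have hI2 : I ≤ (1 + ϑ) * s := by linarith
  have hIb2 : Ib ≤ (1 + ϑ) * s := hIb.trans hI2
  have hm1 : 0 < m1 := by linarith
  have hHIb : H * Ib ≤ (1 - 10 * ϑ) * s ^ 2 + k * s0 * E := by
    have b1 : H * Ib * m1 ≤ (1 + ε) * Ib ^ 2 + E * Ib := by
      have := mul_le_mul_of_nonneg_right hH hIb0
      linarith
    have b2 : Ib ^ 2 ≤ (1 + ϑ) ^ 2 * s ^ 2 := by
      rw [← mul_pow]; exact pow_le_pow_left₀ hIb0 hIb2 2
    have b3 : E * Ib ≤ E * (k * s0) := by gcongr; exact hIbk.trans (by gcongr)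
    have b4 : (1 + ε) * Ib ^ 2 ≤ (1 + ϑ) * ((1 + ϑ) ^ 2 * s ^ 2) := by gcongr
    have b5 : (1 + ϑ) * (1 + ϑ) ^ 2 ≤ (1 - 10 * ϑ) * (1 + 20 * ϑ) := by
      nlinarith [mul_nonneg hϑ.le (sq_nonneg ϑ), mul_nonneg hϑ.le (by linarith : 0 ≤ 1/40 - ϑ),
        mul_nonneg (mul_nonneg hϑ.le hϑ.le) (by linarith : 0 ≤ 1/40 - ϑ)]
    have b6 : (1 - 10 * ϑ) * (1 + 20 * ϑ) ≤ (1 - 10 * ϑ) * m1 :=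
      mul_le_mul_of_nonneg_left hm (by linarith)
    have b7 : E * (k * s0) ≤ E * (k * s0) * m1 := le_mul_of_one_le_right (by positivity) (by linarith)
    have b8 : H * Ib * m1 ≤ ((1 - 10 * ϑ) * s ^ 2 + k * s0 * E) * m1 := by
      have := mul_le_mul_of_nonneg_right (b5.trans b6) (sq_nonneg s)
      linarith
    exact le_of_mul_le_mul_right b8 hm1
  have hXf : (1 - ϑ) * X ≤ (1 - 9 * ϑ) * s ^ 2 + (k * s0 + 2 * i) * E := by
    have := mul_le_mul_of_nonneg_right hLϑ hX0
    linarith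
  have hc1 : (1 + τ) * X ≤ (1 + ϑ) * X := by gcongr
  have hc2 : (1 + ϑ) * X ≤ (1 + 4 * ϑ) * ((1 - ϑ) * X) := by
    have : 1 + ϑ ≤ (1 + 4 * ϑ) * (1 - ϑ) := by nlinarith
    have := mul_le_mul_of_nonneg_right this hX0
    linarith
  have hc3 : (1 + 4 * ϑ) * ((1 - ϑ) * X) ≤
    (1 + 4 * ϑ) * ((1 - 9 * ϑ) * s ^ 2 + (k * s0 + 2 * i) * E) := by gcongr
  have hc4 : (1 + 4 * ϑ) * (1 - 9 * ϑ) ≤ 1 := by nlinarith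
  have hc5 : (1 + 4 * ϑ) * ((k * s0 + 2 * i) * E) ≤ 4 * ((k * s0 + 2 * i) * E) := by
    have : 0 ≤ (k * s0 + 2 * i) * E := by positivity
    gcongr; linarith
  have hc6 := mul_le_mul_of_nonneg_right hEs hE0
  have hc7 := mul_le_mul_of_nonneg_right hc4 (sq_nonneg s)
  linarith


noncomputable def muAvg (p : ℕ → ℝ) (g : ℕ → Measure ℝ) (k₀ : ℕ) : Measure ℝ :=
  ∑ k ∈ Finset.Icc 1 k₀, ENNReal.ofReal ((k : ℝ) * p k) • g k

lemma muAvg_finite (p : ℕ → ℝ) (g : ℕ → Measure ℝ) (hg : ∀ k, IsProbabilityMeasure (g k))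
    (k₀ : ℕ) : IsFiniteMeasure (muAvg p g k₀) := by
  constructor
  rw [muAvg, Measure.finsetSum_apply]
  refine ENNReal.sum_lt_top.2 fun k _ => ?_
  have := hg k
  rw [Measure.smul_apply, smul_eq_mul]
  exact ENNReal.mul_lt_top ENNReal.ofReal_lt_top (measure_lt_top _ _)

lemma muAvg_real (p : ℕ → ℝ) (g : ℕ → Measure ℝ) (hg : ∀ k, IsProbabilityMeasure (g k))
    (hp : ∀ k, 0 ≤ p k) (k₀ : ℕ) (s : Set ℝ) :
    (muAvg p g k₀).real s = ∑ k ∈ Finset.Icc 1 k₀, (k : ℝ) * p k * (g k).real s := by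
  rw [muAvg, Measure.real, Measure.finsetSum_apply, ENNReal.toReal_sum]
  · refine Finset.sum_congr rfl fun k _ => ?_
    have : 0 ≤ (k : ℝ) * p k := mul_nonneg (Nat.cast_nonneg _) (hp k)
    rw [Measure.smul_apply, smul_eq_mul, ENNReal.toReal_mul, ENNReal.toReal_ofReal this, Measure.real]
  · intro k _
    have := hg k
    rw [Measure.smul_apply, smul_eq_mul]
    exact (ENNReal.mul_lt_top ENNReal.ofReal_lt_top (measure_lt_top _ _)).ne

lemma int_bdd {α : Type*} [MeasurableSpace α] (μ : Measure α) [IsFiniteMeasure μ] (f : α → ℝ)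
    (hf : Measurable f) (C : ℝ) (hC : ∀ x, |f x| ≤ C) : Integrable f μ :=
  Integrable.of_bound hf.aestronglyMeasurable C (Eventually.of_forall hC)

lemma muAvg_integral (p : ℕ → ℝ) (g : ℕ → Measure ℝ) (hg : ∀ k, IsProbabilityMeasure (g k))
    (hp : ∀ k, 0 ≤ p k) (k₀ : ℕ) (f : ℝ → ℝ) (hf : Measurable f) (C : ℝ) (hC : ∀ x, |f x| ≤ C) :
    ∫ y, f y ∂(muAvg p g k₀) = ∑ k ∈ Finset.Icc 1 k₀, (k : ℝ) * p k * ∫ y, f y ∂(g k) := by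
  have hi : ∀ k, Integrable f (g k) := fun k => by
    have := hg k; exact int_bdd _ f hf C hC
  rw [muAvg, integral_finsetSum_measure]
  · refine Finset.sum_congr rfl fun k _ => ?_
    have : 0 ≤ (k : ℝ) * p k := mul_nonneg (Nat.cast_nonneg _) (hp k)
    rw [integral_smul_measure, ENNReal.toReal_ofReal this]; rfl
  · intro k _
    exact (hi k).smul_measure ENNReal.ofReal_ne_top

lemma tsum_Icc (p : ℕ → ℝ) (k₀ : ℕ) (hp0 : p 0 = 0) (hB1 : ∀ k, k₀ < k → p k = 0) (c : ℕ → ℝ) :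
    ∑' k, p k * c k = ∑ k ∈ Finset.Icc 1 k₀, p k * c k := by
  apply tsum_eq_sum
  intro k hk
  have : p k = 0 := by
    rcases Nat.eq_zero_or_pos k with h | h
    · rw [h, hp0]
    · apply hB1; simp at hk; exact hk h
  rw [this, zero_mul]

lemma sum_one (p : ℕ → ℝ) (k₀ : ℕ) (hp0 : p 0 = 0) (hB1 : ∀ k, k₀ < k → p k = 0)
    (hs : HasSum p 1) : ∑ k ∈ Finset.Icc 1 k₀, p k = 1 := by
  have := tsum_Icc p k₀ hp0 hB1 (fun _ => 1)
  simp only [mul_one] at this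
  rw [← this, hs.tsum_eq]

lemma prod_meas {k : ℕ} (h : ℝ → ℝ) (hh : Measurable h) :
    Measurable (fun y : Fin k → ℝ => ∏ i, (1 - h (y i))) := by
  fun_prop

lemma prod_bd {k : ℕ} (h : ℝ → ℝ) (h01 : ∀ x, h x ∈ Icc (0:ℝ) 1) (y : Fin k → ℝ) :
    |∏ i, (1 - h (y i))| ≤ 1 := by
  rw [abs_of_nonneg (Finset.prod_nonneg fun i _ => by linarith [(h01 (y i)).2])]
  exact Finset.prod_le_one (fun i _ => by linarith [(h01 (y i)).2])
    (fun i _ => by linarith [(h01 (y i)).1])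

lemma V_eq (p : ℕ → ℝ) (G : (k : ℕ) → Measure (Fin k → ℝ)) (k₀ : ℕ)
    (hG : ∀ k, IsProbabilityMeasure (G k)) (hp0 : p 0 = 0) (hB1 : ∀ k, k₀ < k → p k = 0)
    (hs : HasSum p 1) (h : ℝ → ℝ) (hh : Measurable h) (h01 : ∀ x, h x ∈ Icc (0:ℝ) 1) :
    1 - ∑' k, p k * ∫ y, (∏ i, (1 - h (y i))) ∂(G k)
      = ∑ k ∈ Finset.Icc 1 k₀, p k * ∫ y, (1 - ∏ i, (1 - h (y i))) ∂(G k) := by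
  rw [tsum_Icc p k₀ hp0 hB1]
  nth_rewrite 1 [← sum_one p k₀ hp0 hB1 hs]
  rw [← Finset.sum_sub_distrib]
  refine Finset.sum_congr rfl fun k _ => ?_
  have := hG k
  rw [integral_sub (integrable_const _) (int_bdd _ _ (prod_meas h hh) 1 (prod_bd h h01))]
  simp; ring

lemma avg_ineq (p : ℕ → ℝ) (G : (k : ℕ) → Measure (Fin k → ℝ)) (g : ℕ → Measure ℝ) (k₀ : ℕ)
    (hG : ∀ k, IsProbabilityMeasure (G k)) (hg : ∀ k, IsProbabilityMeasure (g k))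
    (hmarg : ∀ k (i : Fin k), (G k).map (fun y => y i) = g k) (hp : ∀ k, 0 ≤ p k)
    (hp0 : p 0 = 0) (hB1 : ∀ k, k₀ < k → p k = 0) (hs : HasSum p 1)
    (h1 h2 f : ℝ → ℝ) (hh1 : Measurable h1) (h101 : ∀ x, h1 x ∈ Icc (0:ℝ) 1)
    (hh2 : Measurable h2) (h201 : ∀ x, h2 x ∈ Icc (0:ℝ) 1)
    (hf : Measurable f) (C : ℝ) (hC : ∀ x, |f x| ≤ C) (c : ℝ)
    (hpt : ∀ k ∈ Finset.Icc 1 k₀, ∀ a : Fin k → ℝ, ∑ i, f (a i) ≤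
      (1 - ∏ i, (1 - h1 (a i))) - c * (1 - ∏ i, (1 - h2 (a i)))) :
    ∫ y, f y ∂(muAvg p g k₀) ≤ (1 - ∑' k, p k * ∫ y, (∏ i, (1 - h1 (y i))) ∂(G k))
      - c * (1 - ∑' k, p k * ∫ y, (∏ i, (1 - h2 (y i))) ∂(G k)) := by
  rw [V_eq p G k₀ hG hp0 hB1 hs h1 hh1 h101, V_eq p G k₀ hG hp0 hB1 hs h2 hh2 h201,
    muAvg_integral p g hg hp k₀ f hf C hC, Finset.mul_sum, ← Finset.sum_sub_distrib]
  refine Finset.sum_le_sum fun k hk => ?_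
  have := hG k
  have i1 : Integrable (fun y : Fin k → ℝ => 1 - ∏ i, (1 - h1 (y i))) (G k) :=
    (integrable_const _).sub (int_bdd _ _ (prod_meas h1 hh1) 1 (prod_bd h1 h101))
  have i2 : Integrable (fun y : Fin k → ℝ => 1 - ∏ i, (1 - h2 (y i))) (G k) :=
    (integrable_const _).sub (int_bdd _ _ (prod_meas h2 hh2) 1 (prod_bd h2 h201))
  have i3 : ∀ i : Fin k, Integrable (fun y : Fin k → ℝ => f (y i)) (G k) := fun i =>
    int_bdd _ _ (by fun_prop) C (fun y => hC _)
  have e1 : (k : ℝ) * ∫ y, f y ∂(g k) = ∫ y, ∑ i, f (y i) ∂(G k) := by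
    rw [integral_finsetSum _ (fun i _ => i3 i)]
    have : ∀ i : Fin k, ∫ y, f (y i) ∂(G k) = ∫ y, f y ∂(g k) := by
      intro i
      rw [← hmarg k i, integral_map (measurable_pi_apply i).aemeasurable hf.aestronglyMeasurable]
    simp [this]
  have e2 : ∫ y, ∑ i, f (y i) ∂(G k) ≤ ∫ y, ((1 - ∏ i, (1 - h1 (y i)))
      - c * (1 - ∏ i, (1 - h2 (y i)))) ∂(G k) :=
    integral_mono (integrable_finsetSum _ (fun i _ => i3 i)) (i1.sub (i2.const_mul c))
      (fun y => hpt k hk y)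
  rw [integral_sub i1 (i2.const_mul c), integral_const_mul] at e2
  have := mul_le_mul_of_nonneg_left e2 (hp k)
  rw [← e1] at this
  linarith

lemma tail_int (μ : Measure ℝ) [IsFiniteMeasure μ] (B M L : ℝ) (hL : 0 < L)
    (htail : ∀ z, B ≤ z → L * μ.real (Ici z) ≤ μ.real (Ioi (z - M))) (f : ℝ → ℝ)
    (hf : Monotone f) (hf01 : ∀ x, f x ∈ Icc (0:ℝ) 1) :
    L * ∫ y, (Ioi B).indicator f y ∂μ ≤ ∫ y, f (y + M) ∂μ := by
  have hm := hf.measurable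
  have hn : ∀ x, 0 ≤ (Ioi B).indicator f x := fun x => indicator_nonneg (fun y _ => (hf01 y).1) x
  have hmi : Measurable ((Ioi B).indicator f) := hm.indicator measurableSet_Ioi
  have hms : Measurable (fun y => f (y + M)) := by fun_prop
  have i1 : Integrable ((Ioi B).indicator f) μ := int_bdd _ _ hmi 1 (fun x => by
    rw [abs_of_nonneg (hn x)]
    exact (indicator_le_self' (fun _ _ => (hf01 _).1) x).trans (hf01 x).2)
  have i2 : Integrable (fun y => f (y + M)) μ := int_bdd _ _ hms 1 (fun x => by
    rw [abs_of_nonneg (hf01 _).1]; exact (hf01 _).2)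
  have key : ENNReal.ofReal L * ∫⁻ y, ENNReal.ofReal ((Ioi B).indicator f y) ∂μ ≤
      ∫⁻ y, ENNReal.ofReal (f (y + M)) ∂μ := by
    rw [lintegral_eq_lintegral_meas_lt μ (Eventually.of_forall hn) hmi.aemeasurable,
      lintegral_eq_lintegral_meas_lt μ (Eventually.of_forall (fun x => (hf01 _).1)) hms.aemeasurable,
      ← lintegral_const_mul' _ _ ENNReal.ofReal_ne_top]
    refine setLIntegral_mono' measurableSet_Ioi fun t ht => ?_
    have ht0 : 0 < t := ht
    set U := {a | t < (Ioi B).indicator f a} with hU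
    have hUB : ∀ y ∈ U, B < y ∧ t < f y := by
      intro y hy
      by_cases hyB : y ∈ Ioi B
      · rw [hU, mem_ofPred_eq, indicator_of_mem hyB] at hy; exact ⟨hyB, hy⟩
      · rw [hU, mem_ofPred_eq, indicator_of_notMem hyB] at hy; linarith
    rcases U.eq_empty_or_nonempty with he | hne
    · simp [he]
    have hbd : BddBelow U := ⟨B, fun y hy => (hUB y hy).1.le⟩
    set z := sInf U with hz
    have hzB : B ≤ z := le_csInf hne fun y hy => (hUB y hy).1.le
    have hsub : U ⊆ Ici z := fun y hy => csInf_le hbd hy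
    have hsup : Ioi (z - M) ⊆ {a | t < f (a + M)} := by
      intro y hy
      have : z < y + M := by simp only [mem_Ioi] at hy; linarith
      obtain ⟨w, hw, hwy⟩ := exists_lt_of_csInf_lt hne this
      exact (hUB w hw).2.trans_le (hf hwy.le)
    calc ENNReal.ofReal L * μ U ≤ ENNReal.ofReal L * μ (Ici z) := by gcongr
      _ = ENNReal.ofReal (L * μ.real (Ici z)) := by
        rw [ENNReal.ofReal_mul hL.le, ofReal_measureReal]
      _ ≤ ENNReal.ofReal (μ.real (Ioi (z - M))) := ENNReal.ofReal_le_ofReal (htail z hzB)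
      _ = μ (Ioi (z - M)) := ofReal_measureReal
      _ ≤ _ := measure_mono hsup
  rw [← ofReal_integral_eq_lintegral_ofReal i1 (Eventually.of_forall hn),
    ← ofReal_integral_eq_lintegral_ofReal i2 (Eventually.of_forall (fun x => (hf01 _).1)),
    ← ENNReal.ofReal_mul hL.le] at key
  exact (ENNReal.ofReal_le_ofReal_iff (integral_nonneg (fun x => (hf01 _).1))).1 key


lemma mu_facts (μ : Measure ℝ) [IsFiniteMeasure μ] (B M L ε k η m1 : ℝ) (hL : 0 < L)
    (hB : 0 < B) (hMB : 2 * B ≤ M) (hε : 0 ≤ ε) (hε1 : ε ≤ 1)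
    (hμb : m1 ≤ μ.real (Icc (-B) B)) (hμl : μ.real (Iio (-B)) ≤ k * η)
    (htail : ∀ z, B ≤ z → L * μ.real (Ici z) ≤ μ.real (Ioi (z - M))) (h : ℝ → ℝ)
    (hm : Monotone h) (h01 : ∀ x, h x ∈ Icc (0:ℝ) 1)
    (hΦ : ∀ y, (1 + ε) * h y - h y ^ 2 ≤ h (y + M)) :
    let I := ∫ y, h y ∂μ
    let Ib := ∫ y, (Icc (-B) B).indicator h y ∂μ
    let X := ∫ y, h y ^ 2 ∂μ
    let E := ∫ y, (h (y + M) - max (h y) ((1 + ε) * h y - h y ^ 2)) ∂μ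
    0 ≤ Ib ∧ Ib ≤ I ∧ 0 ≤ X ∧ X ≤ I ∧ 0 ≤ E ∧
      X ≤ h B * Ib + k * η * (h B) ^ 2 + (16 * X + 2 * E) / L ∧
      h B * m1 ≤ (1 + ε) * Ib + E := by
  intro I Ib X E
  have hmeas := hm.measurable
  have h0 : ∀ x, 0 ≤ h x := fun x => (h01 x).1
  have h1 : ∀ x, h x ≤ 1 := fun x => (h01 x).2
  have hsq : ∀ x, h x ^ 2 ≤ h x := fun x => by nlinarith [h0 x, h1 x]
  set e : ℝ → ℝ := fun y => h (y + M) - max (h y) ((1 + ε) * h y - h y ^ 2) with he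
  have hM : 0 ≤ M := by linarith
  have he0 : ∀ y, 0 ≤ e y := fun y => by
    have : max (h y) ((1 + ε) * h y - h y ^ 2) ≤ h (y + M) :=
      max_le (hm (by linarith)) (hΦ y)
    simp only [he]; linarith
  have heφ : ∀ y, h (y + M) - (1 + ε) * h y ≤ e y := fun y => by
    have : max (h y) ((1 + ε) * h y - h y ^ 2) ≤ (1 + ε) * h y :=
      max_le (by nlinarith [h0 y]) (by nlinarith [sq_nonneg (h y)])
    simp only [he]; linarith
  have he1 : ∀ y, e y ≤ 1 := fun y => by
    have : h y ≤ max (h y) ((1 + ε) * h y - h y ^ 2) := le_max_left _ _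
    simp only [he]; linarith [h0 y, h1 (y + M)]
  have iI : Integrable h μ := int_bdd _ _ hmeas 1 (fun x => by rw [abs_of_nonneg (h0 x)]; exact h1 x)
  have iIb : Integrable ((Icc (-B) B).indicator h) μ := iI.indicator measurableSet_Icc
  have iX : Integrable (fun y => h y ^ 2) μ := int_bdd _ _ (by fun_prop) 1
    (fun x => by rw [abs_of_nonneg (sq_nonneg _)]; exact (hsq x).trans (h1 x))
  have iE : Integrable e μ := int_bdd _ _ (by fun_prop) 1
    (fun x => by rw [abs_of_nonneg (he0 x)]; exact he1 x)
  have iT : Integrable ((Ioi B).indicator (fun y => h y ^ 2)) μ := iX.indicator measurableSet_Ioi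
  have iS : Integrable (fun y => h (y + M) ^ 2) μ := int_bdd _ _ (by fun_prop) 1
    (fun x => by rw [abs_of_nonneg (sq_nonneg _)]; exact (hsq _).trans (h1 _))
  have iL : Integrable ((Iio (-B)).indicator (fun _ => (h B) ^ 2)) μ :=
    (integrable_const _).indicator measurableSet_Iio
  have iC : Integrable ((Icc (-B) B).indicator (fun _ => h B)) μ :=
    (integrable_const _).indicator measurableSet_Icc
  refine ⟨integral_nonneg fun y => indicator_nonneg (fun z _ => h0 z) y,
    integral_mono iIb iI (fun y => indicator_le_self' (fun _ _ => h0 _) y),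
    integral_nonneg fun y => sq_nonneg _, integral_mono iX iI hsq, integral_nonneg he0, ?_, ?_⟩
  · have t1 := tail_int μ B M L hL htail (fun y => h y ^ 2)
      (fun a b hab => pow_le_pow_left₀ (h0 a) (hm hab) 2)
      (fun x => ⟨sq_nonneg _, (hsq x).trans (h1 x)⟩)
    have t2 : ∫ y, h (y + M) ^ 2 ∂μ ≤ ∫ y, (16 * h y ^ 2 + 2 * e y) ∂μ := by
      refine integral_mono iS ((iX.const_mul 16).add (iE.const_mul 2)) fun y => ?_
      show h (y + M) ^ 2 ≤ 16 * h y ^ 2 + 2 * e y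
      rcases le_total (h (y + M)) (4 * h y) with hc | hc
      · nlinarith [h0 (y + M), he0 y]
      · nlinarith [hsq (y + M), heφ y, h0 y, sq_nonneg (h y)]
    rw [integral_add (iX.const_mul 16) (iE.const_mul 2), integral_const_mul, integral_const_mul] at t2
    have t3 : ∫ y, (Ioi B).indicator (fun y => h y ^ 2) y ∂μ ≤ (16 * X + 2 * E) / L := by
      rw [le_div_iff₀ hL]
      have := t1.trans t2
      linarith
    have t4 : X ≤ ∫ y, (h B * (Icc (-B) B).indicator h y + (Iio (-B)).indicator (fun _ => (h B) ^ 2) y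
        + (Ioi B).indicator (fun y => h y ^ 2) y) ∂μ := by
      refine integral_mono iX (((iIb.const_mul _).add iL).add iT) fun y => ?_
      show h y ^ 2 ≤ h B * (Icc (-B) B).indicator h y + (Iio (-B)).indicator (fun _ => (h B) ^ 2) y
        + (Ioi B).indicator (fun y => h y ^ 2) y
      rcases lt_or_ge y (-B) with c1 | c1
      · have c2 : y ∉ Icc (-B) B := fun hh => by linarith [hh.1]
        have c3 : y ∉ Ioi B := fun hh => by simp only [mem_Ioi] at hh; linarith
        rw [indicator_of_notMem c2, indicator_of_notMem c3, indicator_of_mem (mem_Iio.2 c1)]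
        have := pow_le_pow_left₀ (h0 y) (hm (by linarith : y ≤ B)) 2
        linarith
      · have c3 : y ∉ Iio (-B) := fun hh => by simp only [mem_Iio] at hh; linarith
        rcases lt_or_ge B y with c4 | c4
        · have c2 : y ∉ Icc (-B) B := fun hh => by linarith [hh.2]
          rw [indicator_of_notMem c2, indicator_of_notMem c3, indicator_of_mem (mem_Ioi.2 c4)]
          linarith
        · have c2 : y ∈ Icc (-B) B := ⟨c1, c4⟩
          have c5 : y ∉ Ioi B := fun hh => by simp only [mem_Ioi] at hh; linarith
          rw [indicator_of_mem c2, indicator_of_notMem c3, indicator_of_notMem c5]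
          nlinarith [hm c4, h0 y]
    have iA : Integrable (fun y => h B * (Icc (-B) B).indicator h y +
        (Iio (-B)).indicator (fun _ => (h B) ^ 2) y) μ := (iIb.const_mul _).add iL
    rw [integral_add iA iT, integral_add (iIb.const_mul _) iL,
      integral_const_mul, integral_indicator measurableSet_Iio, setIntegral_const, smul_eq_mul] at t4
    have t5 : μ.real (Iio (-B)) * h B ^ 2 ≤ k * η * h B ^ 2 := by gcongr
    linarith
  · have t1 : ∫ y, (Icc (-B) B).indicator (fun _ => h B) y ∂μ ≤
        ∫ y, ((1 + ε) * (Icc (-B) B).indicator h y + e y) ∂μ := by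
      refine integral_mono iC ((iIb.const_mul _).add iE) fun y => ?_
      show (Icc (-B) B).indicator (fun _ => h B) y ≤ (1 + ε) * (Icc (-B) B).indicator h y + e y
      by_cases c : y ∈ Icc (-B) B
      · rw [indicator_of_mem c, indicator_of_mem c]
        have : h B ≤ h (y + M) := hm (by linarith [c.1])
        linarith [heφ y]
      · rw [indicator_of_notMem c, indicator_of_notMem c]
        linarith [he0 y]
    rw [integral_add (iIb.const_mul _) iE, integral_const_mul, integral_indicator measurableSet_Icc,
      setIntegral_const, smul_eq_mul] at t1
    have := mul_le_mul_of_nonneg_left hμb (h0 B)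
    show h B * m1 ≤ (1 + ε) * Ib + E
    linarith

/-- one step of the recursion preserves the decay inequality -/
lemma one_step (p : ℕ → ℝ) (G : (k : ℕ) → Measure (Fin k → ℝ)) (g : ℕ → Measure ℝ) (k₀ : ℕ)
    (hk₀ : 1 < k₀)
    (hG : ∀ k, IsProbabilityMeasure (G k)) (hg : ∀ k, IsProbabilityMeasure (g k))
    (hmarg : ∀ k (i : Fin k), (G k).map (fun y => y i) = g k) (hp : ∀ k, 0 ≤ p k)
    (hp0 : p 0 = 0) (hB1 : ∀ k, k₀ < k → p k = 0) (hs : HasSum p 1)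
    (m1 ϑ ω η L s0 ε B M : ℝ) (hϑ : 0 < ϑ) (hϑ1 : ϑ ≤ 1/40)
    (hm : 1 + 20 * ϑ ≤ m1) (hω : 0 < ω) (hω1 : ω ≤ 1) (hωK : 4 * ω * k₀ ≤ 1)
    (hη : 0 ≤ η) (hL : 0 < L) (hLϑ : 16 / L ≤ ϑ)
    (hτ : (2 * ε + 9 * ω * k₀) * k₀ ≤ ϑ) (hε : 0 ≤ ε) (hεϑ : ε ≤ ϑ) (hεs : ε ≤ s0) (Γ : ℝ)
    (hΓ : Γ = 2 * k₀ + 4 * k₀ / ω) (hη1 : η ≤ 1) (hηΓ : k₀ * η * Γ ^ 2 ≤ ϑ)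
    (hs0 : 0 < s0) (hsm : 2 * k₀ * (Γ * k₀ * s0 + k₀ * Γ ^ 2 * s0 + 2 * Γ / L) ≤ ϑ)
    (hEs : 4 * (k₀ * s0 + 2 / L) ≤ ω / 2)
    (hB : 0 < B) (hMB : 2 * B ≤ M)
    (hμb : m1 ≤ (muAvg p g k₀).real (Icc (-B) B))
    (hμl : (muAvg p g k₀).real (Iio (-B)) ≤ k₀ * η)
    (htail : ∀ z, B ≤ z → L * (muAvg p g k₀).real (Ici z) ≤ (muAvg p g k₀).real (Ioi (z - M)))
    (u v : ℝ → ℝ) (hu : Antitone u) (hu01 : ∀ x, u x ∈ Icc (0:ℝ) 1)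
    (hv : Antitone v) (hv01 : ∀ x, v x ∈ Icc (0:ℝ) 1)
    (hrec : ∀ x, v x = 1 - ∑' k : ℕ, p k * ∫ y : Fin k → ℝ, (∏ i, (1 - u (x - y i))) ∂(G k))
    (hΦ : ∀ x, (1 + ε) * u x - u x ^ 2 ≤ u (x - M)) (x : ℝ) :
    (1 + ε) * v x - v x ^ 2 ≤ v (x - M) := by
  have hK : (1:ℝ) ≤ k₀ := by exact_mod_cast hk₀.le
  rcases le_total s0 (v x) with hc | hc
  · have := hv (by linarith : x - M ≤ x)
    nlinarith [(hv01 x).1]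
  have hfin := muAvg_finite p g hg k₀
  set μ := muAvg p g k₀ with hμ
  set h : ℝ → ℝ := fun y => u (x - y) with hh
  have hmono : Monotone h := fun a b hab => hu (by linarith)
  have hmeas := hmono.measurable
  have h01 : ∀ y, h y ∈ Icc (0:ℝ) 1 := fun y => hu01 _
  have h0 : ∀ y, 0 ≤ h y := fun x => (h01 x).1
  have h1 : ∀ y, h y ≤ 1 := fun x => (h01 x).2
  have hsq : ∀ x, h x ^ 2 ≤ h x := fun x => by nlinarith [h0 x, h1 x]
  have hhΦ : ∀ y, (1 + ε) * h y - h y ^ 2 ≤ h (y + M) := fun y => by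
    have := hΦ (x - y)
    simp only [hh]
    rwa [show x - (y + M) = x - y - M by ring]
  have hvx : v x = 1 - ∑' k : ℕ, p k * ∫ y : Fin k → ℝ, (∏ i, (1 - h (y i))) ∂(G k) := hrec x
  have hvM : v (x - M) = 1 - ∑' k : ℕ, p k * ∫ y : Fin k → ℝ, (∏ i, (1 - h (y i + M))) ∂(G k) := by
    rw [hrec]; simp only [hh]
    simp only [sub_sub, add_comm M]
  have hε1 : ε ≤ 1 := by linarith
  obtain ⟨f1, f2, f3, f4, f5, f6, f7⟩ := mu_facts μ B M L ε k₀ η m1 hL hB hMB hε hε1 hμb hμl htail h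
    hmono h01 hhΦ
  set I := ∫ y, h y ∂μ with hI
  set Ib := ∫ y, (Icc (-B) B).indicator h y ∂μ
  set X := ∫ y, h y ^ 2 ∂μ with hX
  set e : ℝ → ℝ := fun y => h (y + M) - max (h y) ((1 + ε) * h y - h y ^ 2) with he
  set E := ∫ y, e y ∂μ with hE
  have iI : Integrable h μ := int_bdd _ _ hmeas 1 (fun x => by rw [abs_of_nonneg (h0 x)]; exact h1 x)
  have iX : Integrable (fun y => h y ^ 2) μ := int_bdd _ _ (by fun_prop) 1
    (fun x => by rw [abs_of_nonneg (sq_nonneg _)]; exact (hsq x).trans (h1 x))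
  have heb : ∀ y, |e y| ≤ 4 := fun y => by
    have a1 : h y ≤ max (h y) ((1 + ε) * h y - h y ^ 2) := le_max_left _ _
    have a2 : max (h y) ((1 + ε) * h y - h y ^ 2) ≤ 2 :=
      max_le (by linarith [h1 y]) (by nlinarith [sq_nonneg (h y), h1 y, h0 y])
    simp only [he]
    rw [abs_le]; constructor <;> linarith [h0 y, h1 y, h0 (y + M), h1 (y + M)]
  have hemeas : Measurable e := by fun_prop
  have iE : Integrable e μ := int_bdd _ _ hemeas 4 heb
  have hkc : ∀ k ∈ Finset.Icc 1 k₀, (k : ℝ) ≤ k₀ := fun k hk => by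
    exact_mod_cast (Finset.mem_Icc.1 hk).2
  have s1 : I ≤ k₀ * v x := by
    have := avg_ineq p G g k₀ hG hg hmarg hp hp0 hB1 hs h h (fun y => h y / k₀) hmeas h01 hmeas h01
      (by fun_prop) 1 (fun y => by
        rw [abs_of_nonneg (div_nonneg (h0 y) (by linarith)), div_le_one (by linarith)]
        linarith [h1 y]) 0 (fun k hk a => by
        have := R_first (fun i => h (a i)) k₀ (by linarith) (hkc k hk) (fun i => h0 _) (fun i => h1 _)
        linarith)
    rw [← hvx, integral_div, div_le_iff₀ (by linarith)] at this
    linarith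
  have s2 : I ≤ v x + k₀ * X := by
    have := avg_ineq p G g k₀ hG hg hmarg hp hp0 hB1 hs h h (fun y => h y - k₀ * h y ^ 2) hmeas h01
      hmeas h01 (by fun_prop) (1 + k₀) (fun y => by
        have : (k₀ : ℝ) * h y ^ 2 ≤ k₀ * 1 := by gcongr; exact (hsq y).trans (h1 y)
        have : 0 ≤ (k₀ : ℝ) * h y ^ 2 := by positivity
        rw [abs_le]; constructor <;> linarith [h0 y, h1 y]) 0 (fun k hk a => by
        have := R_second (fun i => h (a i)) k₀ (hkc k hk) (fun i => h0 _) (fun i => h1 _)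
        linarith)
    rw [← hvx, integral_sub iI (iX.const_mul _), integral_const_mul] at this
    linarith
  have s3 : ω / 2 * E - (1 + (2 * ε + 9 * ω * k₀) * k₀) * X ≤ v (x - M) - (1 + ε) * v x := by
    have := avg_ineq p G g k₀ hG hg hmarg hp hp0 hB1 hs (fun y => h (y + M)) h
      (fun y => ω / 2 * e y - (1 + (2 * ε + 9 * ω * k₀) * k₀) * h y ^ 2) (by fun_prop)
      (fun y => h01 _) hmeas h01 (by fun_prop) (ω / 2 * 4 + (1 + (2 * ε + 9 * ω * k₀) * k₀) * 1)
      (fun y => by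
        refine (abs_sub _ _).trans ?_
        rw [abs_mul, abs_mul, abs_of_nonneg (by positivity : 0 ≤ ω / 2),
          abs_of_nonneg (by positivity : 0 ≤ (1 + (2 * ε + 9 * ω * (k₀:ℝ)) * k₀)),
          abs_of_nonneg (sq_nonneg (h y))]
        gcongr
        · exact heb y
        · exact (hsq y).trans (h1 y)) (1 + ε) (fun k hk a =>
        R_lower (fun i => h (a i)) (fun i => h (a i + M)) k₀ (hkc k hk) (fun i => h0 _)
          (fun i => hmono (by linarith)) (fun i => h1 _) ε ω hε hε1 hω hω1 hωK hK (fun i => hhΦ _))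
    rw [← hvx, ← hvM, integral_sub (iE.const_mul _) (iX.const_mul _), integral_const_mul,
      integral_const_mul] at this
    exact this
  have := arith_final k₀ m1 ϑ ω η L s0 ε hK hϑ hϑ1 hm hω hη hL hLϑ hτ hε hεϑ Γ hΓ hη1 hηΓ hs0 hsm hEs
    (v x) I Ib X E (h B) (hv01 x).1 hc f1 f2 s1 f3 f4 s2 f5 (h0 B) f6 f7
  linarith


lemma tail_g (P : Measure ℝ) [IsProbabilityMeasure P] (a M₀ B η L M : ℝ) (ha : 0 < a)
    (hMT2 : ∀ M x : ℝ, M₀ < M → 0 ≤ x → P.real (Ioi (x + M)) ≤ Real.exp (-a * M) * P.real (Ioi x))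
    (hup : P.real (Ioi B) ≤ η) (hlow : P.real (Iio (-B)) ≤ η) (hL : 0 < L)
    (hB : 0 < B) (hLη : L * η ≤ 1 - η) (hM : M₀ < M - B - 1) (hLM : L ≤ Real.exp (a * (M - B - 1))) (z : ℝ)
    (hz : B + 1 ≤ z) : L * P.real (Ici z) ≤ P.real (Ioi (z - M)) := by
  rcases lt_or_ge (z - M) (-B) with hc | hc
  · have h1 : P.real (Ici (-B)) ≤ P.real (Ioi (z - M)) :=
      measureReal_mono (fun y hy => lt_of_lt_of_le hc hy)
    have h2 : P.real (Ici (-B)) = 1 - P.real (Iio (-B)) := by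
      rw [← compl_Iio, probReal_compl_eq_one_sub measurableSet_Iio]
    have h3 : P.real (Ici z) ≤ P.real (Ioi B) :=
      measureReal_mono (Ici_subset_Ioi.2 (by linarith))
    have h4 := mul_le_mul_of_nonneg_left (h3.trans hup) hL.le
    linarith
  · set x := max (z - M) 0 with hx
    have hx0 : 0 ≤ x := le_max_right _ _
    have hx1 : z - M ≤ x := le_max_left _ _
    have hx2 : x ≤ z - M + B := max_le (by linarith) (by linarith)
    have h1 : P.real (Ici z) ≤ P.real (Ioi (z - 1)) :=
      measureReal_mono (Ici_subset_Ioi.2 (by linarith))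
    have h2 := hMT2 (z - 1 - x) x (by linarith) hx0
    rw [show x + (z - 1 - x) = z - 1 by ring] at h2
    have h3 : P.real (Ioi x) ≤ P.real (Ioi (z - M)) := measureReal_mono (Ioi_subset_Ioi hx1)
    have h4 : L * Real.exp (-a * (z - 1 - x)) ≤ 1 := by
      calc L * Real.exp (-a * (z - 1 - x))
          ≤ Real.exp (a * (M - B - 1)) * Real.exp (-a * (z - 1 - x)) := by gcongr
        _ = Real.exp (a * (M - B - 1) + -a * (z - 1 - x)) := (Real.exp_add _ _).symm
        _ ≤ 1 := by rw [Real.exp_le_one_iff]; nlinarith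
    calc L * P.real (Ici z) ≤ L * (Real.exp (-a * (z - 1 - x)) * P.real (Ioi x)) := by
          gcongr; exact h1.trans h2
      _ = (L * Real.exp (-a * (z - 1 - x))) * P.real (Ioi x) := by ring
      _ ≤ 1 * P.real (Ioi x) := by gcongr
      _ ≤ _ := by linarith

lemma int_split {α : Type*} [MeasurableSpace α] (P : Measure α) [IsProbabilityMeasure P] (A : Set α)
    (hA : MeasurableSet A) (η c : ℝ) (hc : 0 ≤ c) (hPA : 1 - η ≤ (P A).toReal) (f : α → ℝ)
    (hf : Measurable f) (hf0 : ∀ y, 0 ≤ f y) (hf1 : ∀ y, f y ≤ 1) (hfA : ∀ y ∈ A, f y ≤ c) :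
    ∫ y, f y ∂P ≤ c + η := by
  have i1 : Integrable f P := int_bdd _ _ hf 1 (fun x => by rw [abs_of_nonneg (hf0 x)]; exact hf1 x)
  have i2 : Integrable (Aᶜ.indicator (fun _ => (1:ℝ))) P := (integrable_const _).indicator hA.compl
  have h : ∫ y, f y ∂P ≤ ∫ y, (c + Aᶜ.indicator (fun _ => (1:ℝ)) y) ∂P := by
    refine integral_mono i1 ((integrable_const _).add i2) fun y => ?_
    show f y ≤ c + Aᶜ.indicator (fun _ => (1:ℝ)) y
    by_cases hy : y ∈ A
    · rw [indicator_of_notMem (by simpa using hy)]; linarith [hfA y hy]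
    · rw [indicator_of_mem (by simpa using hy)]; linarith [hf1 y]
  rw [integral_add (integrable_const _) i2, integral_indicator hA.compl, setIntegral_const,
    probReal_compl_eq_one_sub hA] at h
  simp at h
  have : P.real A = (P A).toReal := rfl
  linarith

lemma step_up (p : ℕ → ℝ) (G : (k : ℕ) → Measure (Fin k → ℝ)) (k₀ : ℕ)
    (hG : ∀ k, IsProbabilityMeasure (G k)) (hp : ∀ k, 0 ≤ p k)
    (hp0 : p 0 = 0) (hB1 : ∀ k, k₀ < k → p k = 0) (hs : HasSum p 1) (B η : ℝ)
    (hGT : ∀ k, p k ≠ 0 → 1 - η ≤ ((G k) {y | ∀ i, y i ≤ B}).toReal)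
    (u v : ℝ → ℝ) (hu : Antitone u) (hu01 : ∀ x, u x ∈ Icc (0:ℝ) 1)
    (hrec : ∀ x, v x = 1 - ∑' k : ℕ, p k * ∫ y : Fin k → ℝ, (∏ i, (1 - u (x - y i))) ∂(G k))
    (x : ℝ) : v (x + B) ≤ k₀ * u x + η := by
  have hm := hu.measurable
  rw [hrec, V_eq p G k₀ hG hp0 hB1 hs (fun y => u (x + B - y)) (by fun_prop) (fun y => hu01 _)]
  have hone := sum_one p k₀ hp0 hB1 hs
  calc _ ≤ ∑ k ∈ Finset.Icc 1 k₀, p k * (k₀ * u x + η) := by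
        refine Finset.sum_le_sum fun k hk => ?_
        by_cases hpk : p k = 0
        · simp [hpk]
        refine mul_le_mul_of_nonneg_left ?_ (hp k)
        have := hG k
        refine int_split (G k) {y | ∀ i, y i ≤ B} ?_ η _
          (mul_nonneg (Nat.cast_nonneg _) (hu01 x).1) (hGT k hpk) _ ?_ ?_ ?_ ?_
        · rw [ofPred_forall]
          exact MeasurableSet.iInter fun i => measurableSet_le (measurable_pi_apply i) measurable_const
        · fun_prop
        · intro y
          have := prod_bd (fun y => u (x + B - y)) (fun y => hu01 _) y
          linarith [abs_le.1 this]
        · intro y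
          have := Finset.prod_nonneg (s := Finset.univ) (f := fun i => 1 - u (x + B - y i))
            (fun i _ => by linarith [(hu01 (x + B - y i)).2])
          linarith
        · intro y hy
          have h1 := aux_one_sub Finset.univ (fun i => u (x + B - y i)) (fun i => (hu01 _).1)
            (fun i => (hu01 _).2)
          have h2 : ∑ i, u (x + B - y i) ≤ ∑ i : Fin k, u x :=
            Finset.sum_le_sum fun i _ => hu (by linarith [hy i])
          have h3 : (k : ℝ) * u x ≤ k₀ * u x := by
            have : (k : ℝ) ≤ k₀ := by exact_mod_cast (Finset.mem_Icc.1 hk).2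
            exact mul_le_mul_of_nonneg_right this (hu01 x).1
          simp only [Finset.sum_const, Finset.card_univ, Fintype.card_fin, nsmul_eq_mul] at h2
          linarith
    _ = _ := by rw [← Finset.sum_mul, hone, one_mul]

lemma step_down (p : ℕ → ℝ) (G : (k : ℕ) → Measure (Fin k → ℝ)) (k₀ : ℕ) (hk₀ : 1 < k₀)
    (hG : ∀ k, IsProbabilityMeasure (G k)) (hp : ∀ k, 0 ≤ p k)
    (hp0 : p 0 = 0) (hB1 : ∀ k, k₀ < k → p k = 0) (hs : HasSum p 1) (B η m₀ : ℝ)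
    (hB2 : m₀ < ∑ k ∈ Finset.Icc 1 k₀, (k : ℝ) * p k)
    (hGT : ∀ k, p k ≠ 0 → 1 - η ≤ ((G k) {y | ∀ i, -B ≤ y i}).toReal)
    (u v : ℝ → ℝ) (hu : Antitone u) (hu01 : ∀ x, u x ∈ Icc (0:ℝ) 1)
    (hrec : ∀ x, v x = 1 - ∑' k : ℕ, p k * ∫ y : Fin k → ℝ, (∏ i, (1 - u (x - y i))) ∂(G k))
    (x : ℝ) : 1 - v (x - B) ≤ (1 - u x) - (m₀ - 1) / k₀ * ((1 - u x) * u x) + η := by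
  have hm := hu.measurable
  have hone := sum_one p k₀ hp0 hB1 hs
  set q := 1 - u x with hq
  have hq0 : 0 ≤ q := by linarith [(hu01 x).2]
  have hq1 : q ≤ 1 := by linarith [(hu01 x).1]
  have hK : (1:ℝ) < k₀ := by exact_mod_cast hk₀
  rw [hrec, tsum_Icc p k₀ hp0 hB1, sub_sub_cancel]
  calc _ ≤ ∑ k ∈ Finset.Icc 1 k₀, p k * (q - (k - 1) / k₀ * (q * u x) + η) := by
        refine Finset.sum_le_sum fun k hk => ?_
        by_cases hpk : p k = 0
        · simp [hpk]
        refine mul_le_mul_of_nonneg_left ?_ (hp k)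
        have := hG k
        have hk1 := (Finset.mem_Icc.1 hk).1
        have hk2 : (k : ℝ) ≤ k₀ := by exact_mod_cast (Finset.mem_Icc.1 hk).2
        have hqu : 0 ≤ q * u x := mul_nonneg hq0 (hu01 x).1
        have hqk : q ^ k ≤ q - (k - 1) / k₀ * (q * u x) := by
          rcases Nat.eq_or_lt_of_le hk1 with h | h
          · rw [← h]; simp
          · have h2 : q ^ k ≤ q ^ 2 := pow_le_pow_of_le_one hq0 hq1 h
            have h3 : ((k : ℝ) - 1) / k₀ ≤ 1 := by rw [div_le_one (by linarith)]; linarith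
            have h4 := mul_le_mul_of_nonneg_right h3 hqu
            have h5 : q ^ 2 = q - 1 * (q * u x) := by rw [hq]; ring
            linarith
        refine int_split (G k) {y | ∀ i, -B ≤ y i} ?_ η _
          ((pow_nonneg hq0 k).trans hqk) (hGT k hpk) _ ?_ ?_ ?_ ?_
        · rw [ofPred_forall]
          exact MeasurableSet.iInter fun i => measurableSet_le measurable_const (measurable_pi_apply i)
        · fun_prop
        · intro y
          exact Finset.prod_nonneg (fun i _ => by linarith [(hu01 (x - B - y i)).2])
        · intro y
          have := prod_bd (fun y => u (x - B - y)) (fun y => hu01 _) y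
          exact (abs_le.1 this).2
        · intro y hy
          refine le_trans ?_ hqk
          calc ∏ i, (1 - u (x - B - y i)) ≤ ∏ i : Fin k, q :=
                Finset.prod_le_prod (fun i _ => by linarith [(hu01 (x - B - y i)).2]) fun i _ => by
                  have : u x ≤ u (x - B - y i) := hu (by linarith [hy i])
                  linarith
            _ = q ^ k := by simp
    _ = (q + η) * ∑ k ∈ Finset.Icc 1 k₀, p k - (q * u x) / k₀ * (∑ k ∈ Finset.Icc 1 k₀, (k : ℝ) * p k
          - ∑ k ∈ Finset.Icc 1 k₀, p k) := by
        rw [← Finset.sum_sub_distrib, Finset.mul_sum, Finset.mul_sum, ← Finset.sum_sub_distrib]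
        refine Finset.sum_congr rfl fun k _ => ?_
        ring
    _ ≤ _ := by
        rw [hone]
        have h1 : 0 ≤ (q * u x) / k₀ := div_nonneg (mul_nonneg hq0 (hu01 x).1) (by linarith)
        have h2 := mul_le_mul_of_nonneg_left hB2.le h1
        have h3 : (m₀ - 1) / k₀ * (q * u x) = (q * u x) / k₀ * (m₀ - 1) := by ring
        rw [h3]
        linarith

lemma consts (k m₀ : ℝ) (hk : 1 ≤ k) (hm₀ : 1 < m₀) : ∃ m1 ϑ ω η L s0 ε Γ : ℝ, 0 < ϑ ∧ ϑ ≤ 1/40 ∧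
    1 + 20 * ϑ ≤ m1 ∧ 0 < ω ∧ ω ≤ 1 ∧ 4 * ω * k ≤ 1 ∧ 0 < η ∧ 0 < L ∧ 16 / L ≤ ϑ ∧
    (2 * ε + 9 * ω * k) * k ≤ ϑ ∧ 0 < ε ∧ ε ≤ ϑ ∧ ε ≤ s0 ∧ Γ = 2 * k + 4 * k / ω ∧ η ≤ 1 ∧
    k * η * Γ ^ 2 ≤ ϑ ∧ 0 < s0 ∧ 2 * k * (Γ * k * s0 + k * Γ ^ 2 * s0 + 2 * Γ / L) ≤ ϑ ∧
    4 * (k * s0 + 2 / L) ≤ ω / 2 ∧ m1 + 2 * (k * η) ≤ m₀ ∧ L * η ≤ 1 - η := by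
  have hk0 : 0 < k := by linarith
  obtain ⟨ϑ, hϑ, hϑ1, hϑm⟩ : ∃ ϑ : ℝ, 0 < ϑ ∧ ϑ ≤ 1/40 ∧ 40 * ϑ ≤ m₀ - 1 :=
    ⟨min ((m₀ - 1)/40) (1/40), lt_min (by linarith) (by norm_num), min_le_right _ _, by
      linarith [min_le_left ((m₀ - 1)/40) (1/40)]⟩
  obtain ⟨ω, hω, hωd⟩ : ∃ ω : ℝ, 0 < ω ∧ 18 * ω * k ^ 2 = ϑ :=
    ⟨ϑ / (18 * k ^ 2), by positivity, by field_simp⟩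
  have hkk : k ≤ k ^ 2 := by nlinarith
  have hωk : ω * k ≤ ω * k ^ 2 := by gcongr
  have hωk' : ω ≤ ω * k := by nlinarith
  obtain ⟨Γ, hΓ⟩ : ∃ Γ, Γ = 2 * k + 4 * k / ω := ⟨_, rfl⟩
  have hΓ0 : 0 < Γ := by rw [hΓ]; positivity
  obtain ⟨L, hL, hL1, hL2, hL3⟩ : ∃ L : ℝ, 0 < L ∧ 16 / L ≤ ϑ ∧ 4 * k * Γ / L ≤ ϑ / 2 ∧ 8 / L ≤ ω / 4 := by
    have h1 : 0 < 16 / ϑ := by positivity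
    have h2 : 0 < 4 * k * Γ / (ϑ / 2) := by positivity
    have h3 : 0 < 8 / (ω / 4) := by positivity
    refine ⟨16 / ϑ + 4 * k * Γ / (ϑ / 2) + 8 / (ω / 4), by positivity, ?_, ?_, ?_⟩
    · rw [div_le_comm₀ (by positivity) (by positivity)]; linarith
    · rw [div_le_comm₀ (by positivity) (by positivity)]; linarith
    · rw [div_le_comm₀ (by positivity) (by positivity)]; linarith
  obtain ⟨s0, hs0, hs1, hs2⟩ : ∃ s0 : ℝ, 0 < s0 ∧ s0 * (2 * k * (Γ * k + k * Γ ^ 2)) ≤ ϑ / 2 ∧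
      s0 * (4 * k) ≤ ω / 4 :=
    ⟨min (ϑ / 2 / (2 * k * (Γ * k + k * Γ ^ 2))) (ω / 4 / (4 * k)), by positivity,
      by rw [← le_div_iff₀ (by positivity)]; exact min_le_left _ _,
      by rw [← le_div_iff₀ (by positivity)]; exact min_le_right _ _⟩
  obtain ⟨ε, hε, he1, he2, he3⟩ : ∃ ε : ℝ, 0 < ε ∧ ε * (4 * k) ≤ ϑ ∧ ε ≤ s0 ∧ ε ≤ ϑ :=
    ⟨min (ϑ / (4 * k)) (min s0 ϑ), by positivity,
      by rw [← le_div_iff₀ (by positivity)]; exact min_le_left _ _,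
      (min_le_right _ _).trans (min_le_left _ _), (min_le_right _ _).trans (min_le_right _ _)⟩
  obtain ⟨η, hη, hη1, hη2, hη3, hη4⟩ : ∃ η : ℝ, 0 < η ∧ η ≤ 1 ∧ η * (k * Γ ^ 2) ≤ ϑ ∧
      η * (2 * k) ≤ 20 * ϑ ∧ η * (L + 1) ≤ 1 :=
    ⟨min (min 1 (ϑ / (k * Γ ^ 2))) (min (20 * ϑ / (2 * k)) (1 / (L + 1))), by positivity,
      (min_le_left _ _).trans (min_le_left _ _),
      by rw [← le_div_iff₀ (by positivity)]; exact (min_le_left _ _).trans (min_le_right _ _),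
      by rw [← le_div_iff₀ (by positivity)]; exact (min_le_right _ _).trans (min_le_left _ _),
      by rw [← le_div_iff₀ (by positivity)]; exact (min_le_right _ _).trans (min_le_right _ _)⟩
  refine ⟨1 + 20 * ϑ, ϑ, ω, η, L, s0, ε, Γ, hϑ, hϑ1, le_rfl, hω, by linarith, by linarith, hη, hL, hL1,
    by nlinarith, hε, he3, he2, hΓ, hη1, by linarith, hs0, ?_, ?_, by linarith, by linarith⟩
  · have : 2 * k * (Γ * k * s0 + k * Γ ^ 2 * s0 + 2 * Γ / L)
      = s0 * (2 * k * (Γ * k + k * Γ ^ 2)) + 4 * k * Γ / L := by ring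
    linarith
  · have : 4 * (k * s0 + 2 / L) = s0 * (4 * k) + 8 / L := by ring
    linarith


lemma limits_F (F : ℕ → ℕ → ℝ → ℝ) (k c : ℝ) (hk : 1 ≤ k) (hc : 0 ≤ c)
    (hF01 : ∀ n m, m ≤ n → ∀ x, F n m x ∈ Icc (0 : ℝ) 1)
    (hFn1 : ∀ n (x : ℝ), x < 0 → F n n x = 1)
    (hFn0 : ∀ n (x : ℝ), 0 ≤ x → F n n x = 0)
    (hstep : ∀ η : ℝ, 0 < η → ∃ B : ℝ, 0 < B ∧ ∀ n m, m < n → ∀ x,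
      F n m (x + B) ≤ k * F n (m + 1) x + η ∧
      1 - F n m (x - B) ≤ (1 - F n (m + 1) x) - c * ((1 - F n (m + 1) x) * F n (m + 1) x) + η) :
    ∀ d n m, m + d = n → ∀ r : ℝ, 0 < r → (∃ x, F n m x ≤ r) ∧ (∃ x, 1 - r ≤ F n m x) := by
  intro d
  induction d with
  | zero =>
    intro n m hmn r hr
    simp only [add_zero] at hmn
    subst hmn
    exact ⟨⟨0, by rw [hFn0 _ _ le_rfl]; exact hr.le⟩, ⟨-1, by rw [hFn1 _ _ (by norm_num)]; linarith⟩⟩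
  | succ d ih =>
    intro n m hmn r hr
    have hlt : m < n := by omega
    obtain ⟨B, hB, hst⟩ := hstep (r / 2) (by linarith)
    obtain ⟨⟨x, hx⟩, _⟩ := ih n (m + 1) (by omega) (r / (2 * k)) (by positivity)
    obtain ⟨_, ⟨x', hx'⟩⟩ := ih n (m + 1) (by omega) (r / 2) (by positivity)
    refine ⟨⟨x + B, ?_⟩, ⟨x' - B, ?_⟩⟩
    · have h1 := (hst n m hlt x).1
      have h2 : k * F n (m + 1) x ≤ k * (r / (2 * k)) := by gcongr
      have h3 : k * (r / (2 * k)) = r / 2 := by field_simp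
      linarith
    · have h1 := (hst n m hlt x').2
      have h01 := hF01 n (m + 1) hlt x'
      have : 0 ≤ c * ((1 - F n (m + 1) x') * F n (m + 1) x') :=
        mul_nonneg hc (mul_nonneg (by linarith [h01.2]) h01.1)
      linarith

lemma final_tight (F : ℕ → ℕ → ℝ → ℝ) (k c : ℝ) (hk : 1 ≤ k) (hc : 0 < c) (hc1 : c ≤ 1)
    (hF01 : ∀ n m, m ≤ n → ∀ x, F n m x ∈ Icc (0 : ℝ) 1)
    (hFanti : ∀ n m, m ≤ n → Antitone (F n m))
    (hFn1 : ∀ n (x : ℝ), x < 0 → F n n x = 1)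
    (hFn0 : ∀ n (x : ℝ), 0 ≤ x → F n n x = 0)
    (hstep : ∀ η : ℝ, 0 < η → ∃ B : ℝ, 0 < B ∧ ∀ n m, m < n → ∀ x,
      F n m (x + B) ≤ k * F n (m + 1) x + η ∧
      1 - F n m (x - B) ≤ (1 - F n (m + 1) x) - c * ((1 - F n (m + 1) x) * F n (m + 1) x) + η)
    (ε M : ℝ) (hε : 0 < ε) (hε1 : ε ≤ 1) (hM : 0 < M)
    (hΦ : ∀ n m, m ≤ n → ∀ x, (1 + ε) * F n m x - F n m x ^ 2 ≤ F n m (x - M))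
    (ζ : ℝ) (hζ : 0 < ζ) : ∃ K : ℝ, 0 < K ∧ ∃ N : ℕ, ∀ n, N ≤ n → ∃ x,
      F n 0 (x + K) ≤ ζ ∧ 1 - ζ ≤ F n 0 (x - K) := by
  set T : ℝ → Prop := fun l => ∀ r : ℝ, 0 < r → ∃ K : ℝ, 0 < K ∧ ∃ N : ℕ, ∀ n m, m + N ≤ n → ∃ x,
      F n m (x + K) ≤ r ∧ l ≤ F n m (x - K) with hT
  have hTmono : ∀ l l', l' ≤ l → T l → T l' := by
    intro l l' hl h r hr
    obtain ⟨K, hK, N, h⟩ := h r hr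
    refine ⟨K, hK, N, fun n m hmn => ?_⟩
    obtain ⟨x, h1, h2⟩ := h n m hmn
    exact ⟨x, h1, hl.trans h2⟩
  set δ := ε / 2 with hδ
  have hδ0 : 0 < δ := by positivity
  have hδ1 : δ < 1 := by linarith
  -- base
  have hbase : T δ := by
    intro r hr
    have hdec : ∀ n m, m ≤ n → ∀ x, F n m x ≤ δ → ∀ j : ℕ, F n m (x + j * M) ≤ (1 / (1 + δ)) ^ j := by
      intro n m hmn x hx j
      induction j with
      | zero => simp; exact (hF01 n m hmn x).2
      | succ j ih =>
        have h1 := hΦ n m hmn (x + (j + 1 : ℕ) * M)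
        have h2 : x + (j + 1 : ℕ) * M - M = x + j * M := by push_cast; ring
        rw [h2] at h1
        set w := F n m (x + (j + 1 : ℕ) * M)
        have hw0 : 0 ≤ w := (hF01 n m hmn _).1
        have hwδ : w ≤ δ := (hFanti n m hmn (by
          have : (0:ℝ) ≤ (j + 1 : ℕ) * M := by positivity
          linarith)).trans hx
        have h3 : w * (1 + δ) ≤ F n m (x + j * M) := by nlinarith
        rw [pow_succ, mul_one_div, le_div_iff₀ (by linarith)]
        exact h3.trans ih
    obtain ⟨j, hj⟩ := exists_pow_lt_of_lt_one hr (show 1 / (1 + δ) < 1 by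
      rw [div_lt_one (by linarith)]; linarith)
    refine ⟨j * M + 1, by positivity, 0, fun n m hmn => ?_⟩
    have hmn' : m ≤ n := by omega
    obtain ⟨⟨x1, hx1⟩, -⟩ := limits_F F k c hk hc.le hF01 hFn1 hFn0 hstep (n - m) n m (by omega) δ hδ0
    obtain ⟨-, ⟨x2, hx2⟩⟩ := limits_F F k c hk hc.le hF01 hFn1 hFn0 hstep (n - m) n m (by omega)
      ((1 - δ) / 2) (by linarith)
    set U := {x | F n m x ≤ δ} with hU
    have hne : U.Nonempty := ⟨x1, hx1⟩
    have hbd : BddBelow U := ⟨x2, fun y hy => by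
      by_contra hcon
      push Not at hcon
      have := hFanti n m hmn' hcon.le
      have hy' : F n m y ≤ δ := hy
      linarith⟩
    refine ⟨sInf U, ?_, ?_⟩
    · obtain ⟨w, hw, hwl⟩ := exists_lt_of_csInf_lt hne (lt_add_one (sInf U))
      have h1 := hdec n m hmn' w hw j
      have h2 : F n m (sInf U + (j * M + 1)) ≤ F n m (w + j * M) := hFanti n m hmn' (by linarith)
      linarith
    · by_contra hcon
      push Not at hcon
      have : sInf U ≤ sInf U - (j * M + 1) := csInf_le hbd hcon.le
      have : (0:ℝ) ≤ j * M := by positivity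
      linarith
  -- step
  have hTstep : ∀ l η, 0 ≤ l → 0 < η → T l → T (l + c * (l * (1 - l)) - η) := by
    intro l η hl hη hTl r hr
    obtain ⟨B, hB, hst⟩ := hstep (min η (r / 2)) (lt_min hη (by linarith))
    obtain ⟨K, hK, N, h⟩ := hTl (r / (2 * k)) (by positivity)
    refine ⟨K + B, by linarith, N + 1, fun n m hmn => ?_⟩
    obtain ⟨x, h1, h2⟩ := h n (m + 1) (by omega)
    have hlt : m < n := by omega
    refine ⟨x, ?_, ?_⟩
    · have h3 := (hst n m hlt (x + K)).1
      rw [add_assoc] at h3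
      have h4 : k * F n (m + 1) (x + K) ≤ k * (r / (2 * k)) := by gcongr
      have h5 : k * (r / (2 * k)) = r / 2 := by field_simp
      linarith [min_le_right η (r / 2)]
    · have h3 := (hst n m hlt (x - K)).2
      rw [sub_sub] at h3
      have h01 := hF01 n (m + 1) hlt (x - K)
      set f := F n (m + 1) (x - K)
      have hf1 : f ≤ 1 := h01.2
      have h6 : 0 ≤ 1 + c * (1 - f - l) := by nlinarith
      have h7 : 0 ≤ (f - l) * (1 + c * (1 - f - l)) := mul_nonneg (by linarith) h6
      have h8 := min_le_left η (r / 2)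
      nlinarith
  -- conclusion
  have hTall : T (1 - ζ) := by
    rcases le_total (1 - ζ) δ with h | h
    · exact hTmono _ _ h hbase
    set κ := c * δ * ζ / 2 with hκ
    have hκ0 : 0 < κ := by positivity
    have hj : ∀ j : ℕ, T (min (δ + j * κ) (1 - ζ)) := by
      intro j
      induction j with
      | zero => exact hTmono _ _ (by simp) hbase
      | succ j ih =>
        set l := min (δ + j * κ) (1 - ζ) with hl
        have hlδ : δ ≤ l := le_min (by have : (0:ℝ) ≤ j * κ := by positivity
                                       linarith) h
        have hlζ : l ≤ 1 - ζ := min_le_right _ _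
        refine hTmono _ _ ?_ (hTstep l κ (by linarith) hκ0 ih)
        have h1 : δ * ζ ≤ l * (1 - l) := mul_le_mul hlδ (by linarith) hζ.le (by linarith)
        have h2 := mul_le_mul_of_nonneg_left h1 hc.le
        have h3 : l + κ ≤ l + c * (l * (1 - l)) - κ := by linarith
        refine le_trans ?_ h3
        push_cast
        rcases min_cases (δ + j * κ) (1 - ζ) with ⟨h5, _⟩ | ⟨h5, _⟩
        · rw [hl, h5]; exact (min_le_left _ _).trans (by linarith)
        · rw [hl, h5]; exact (min_le_right _ _).trans (by linarith)
    obtain ⟨j, hj'⟩ := exists_nat_gt (1 / κ)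
    rw [div_lt_iff₀ hκ0] at hj'
    exact hTmono _ _ (le_min (by linarith) le_rfl) (hj j)
  obtain ⟨K, hK, N, h⟩ := hTall ζ hζ
  exact ⟨K, hK, N, fun n hn => h n 0 (by omega)⟩


lemma marg_bd {k : ℕ} (G : Measure (Fin k → ℝ)) (g : Measure ℝ) (hG : IsProbabilityMeasure G)
    (i : Fin k) (hm : G.map (fun y => y i) = g) (B η : ℝ)
    (h1 : 1 - η ≤ (G {y | ∀ i, y i ≤ B}).toReal) (h2 : 1 - η ≤ (G {y | ∀ i, -B ≤ y i}).toReal) :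
    g.real (Ioi B) ≤ η ∧ g.real (Iio (-B)) ≤ η := by
  have hmi : Measurable (fun y : Fin k → ℝ => y i) := measurable_pi_apply i
  subst hm
  have := Measure.isProbabilityMeasure_map (μ := G) hmi.aemeasurable
  constructor
  · have h3 : (G.map (fun y => y i)).real (Ioi B) = 1 - (G.map (fun y => y i)).real (Iic B) := by
      rw [← compl_Iic, probReal_compl_eq_one_sub measurableSet_Iic]
    have h4 : (G {y | ∀ i, y i ≤ B}).toReal ≤ (G.map (fun y => y i)).real (Iic B) := by
      rw [map_measureReal_apply hmi measurableSet_Iic]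
      exact measureReal_mono (μ := G) (fun y hy => hy i)
    linarith
  · have h3 : (G.map (fun y => y i)).real (Iio (-B)) = 1 - (G.map (fun y => y i)).real (Ici (-B)) := by
      rw [← compl_Ici, probReal_compl_eq_one_sub measurableSet_Ici]
    have h4 : (G {y | ∀ i, -B ≤ y i}).toReal ≤ (G.map (fun y => y i)).real (Ici (-B)) := by
      rw [map_measureReal_apply hmi measurableSet_Ici]
      exact measureReal_mono (μ := G) (fun y hy => hy i)
    linarith

lemma med_tight (f : ℝ → ℝ) (hf : Monotone f) (ζ K x md : ℝ) (hζ : ζ ≤ 1 / 4)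
    (hmd : md = sInf {x | 1 / 2 ≤ f x}) (hlo : f (x - K) ≤ ζ) (hhi : 1 - ζ ≤ f (x + K)) :
    1 - 2 * ζ ≤ f (md + 2 * K) - f (md - 2 * K) := by
  have hbd : ∀ y ∈ {x | 1 / 2 ≤ f x}, x - K ≤ y := by
    intro y hy
    by_contra hcon
    push Not at hcon
    have h1 := hf hcon.le
    have h2 : 1 / 2 ≤ f y := hy
    linarith
  have hmem : x + K ∈ {x | 1 / 2 ≤ f x} := by
    change 1 / 2 ≤ f (x + K)
    linarith
  have h1 : md ≤ x + K := by rw [hmd]; exact csInf_le ⟨_, hbd⟩ hmem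
  have h2 : x - K ≤ md := by rw [hmd]; exact le_csInf ⟨_, hmem⟩ hbd
  have h3 := hf (by linarith : x + K ≤ md + 2 * K)
  have h4 := hf (by linarith : md - 2 * K ≤ x - K)
  linarith

lemma finite_tight (Fd : ℕ → ℝ → ℝ) (hmono : ∀ n, Monotone (Fd n))
    (hFdBot : ∀ n, Tendsto (Fd n) atBot (nhds 0))
    (hFdTop : ∀ n, Tendsto (Fd n) atTop (nhds 1)) (Med : ℕ → ℝ) (ε : ℝ) (hε : 0 < ε) (N : ℕ) :
    ∃ K : ℝ, 0 < K ∧ ∀ n, n < N → 1 - ε ≤ Fd n (Med n + K) - Fd n (Med n - K) := by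
  induction N with
  | zero => exact ⟨1, one_pos, fun n hn => by omega⟩
  | succ N ih =>
    obtain ⟨K, hK, h⟩ := ih
    obtain ⟨x1, h1⟩ := ((hFdBot N).eventually_lt_const (by linarith : 0 < ε / 2)).exists
    obtain ⟨x2, h2⟩ := ((hFdTop N).eventually_const_lt (by linarith : 1 - ε / 2 < 1)).exists
    refine ⟨K + |Med N - x1| + |x2 - Med N|, by positivity, fun n hn => ?_⟩
    have ha := abs_nonneg (Med N - x1)
    have hb := abs_nonneg (x2 - Med N)
    rcases Nat.lt_succ_iff_lt_or_eq.1 hn with hn | hn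
    · have h3 := h n hn
      have h4 := hmono n (by linarith : Med n + K ≤ Med n + (K + |Med N - x1| + |x2 - Med N|))
      have h5 := hmono n (by linarith : Med n - (K + |Med N - x1| + |x2 - Med N|) ≤ Med n - K)
      linarith
    · subst hn
      have h4 := hmono n (by linarith [le_abs_self (x2 - Med n)] :
        x2 ≤ Med n + (K + |Med n - x1| + |x2 - Med n|))
      have h5 := hmono n (by linarith [le_abs_self (Med n - x1)] :
        Med n - (K + |Med n - x1| + |x2 - Med n|) ≤ x1)
      linarith

/-- Under assumptions (B1), (B2), (MT1), (MT2) and (GT), the family of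
recentered maxima distributions `{F_n(· − Med(F_n))}` is tight: for every `ε > 0` there is
`K > 0` such that for all `n`, `F_n(Med(F_n)+K) − F_n(Med(F_n)−K) ≥ 1 − ε`. -/
theorem stmt_2
    (p : ℕ → ℕ → ℝ)
    (G : (n : ℕ) → (k : ℕ) → Measure (Fin k → ℝ))
    (g : ℕ → ℕ → Measure ℝ)
    (hp0 : ∀ n, p n 0 = 0)
    (hpnonneg : ∀ n k, 0 ≤ p n k)
    (hpsum : ∀ n, HasSum (p n) 1)
    (hpmean : ∀ n, Summable (fun k : ℕ => (k : ℝ) * p n k))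
    (hGprob : ∀ n k, IsProbabilityMeasure (G n k))
    (hgprob : ∀ n k, IsProbabilityMeasure (g n k))
    (hmarg : ∀ n k (i : Fin k), (G n k).map (fun y => y i) = g n k)
    (gbar : ℕ → ℕ → ℝ → ℝ)
    (hgbar : ∀ n k x, gbar n k x = ((g n k) (Ioi x)).toReal)
    (F : ℕ → ℕ → ℝ → ℝ)
    (hF01 : ∀ n m, m ≤ n → ∀ x, F n m x ∈ Icc (0 : ℝ) 1)
    (hFanti : ∀ n m, m ≤ n → Antitone (F n m))
    (hFrc : ∀ n m, m ≤ n → ∀ x, ContinuousWithinAt (F n m) (Ici x) x)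
    (hFn1 : ∀ n (x : ℝ), x < 0 → F n n x = 1)
    (hFn0 : ∀ n (x : ℝ), 0 ≤ x → F n n x = 0)
    (hrec : ∀ n m, m < n → ∀ x : ℝ,
      F n m x = 1 - ∑' k : ℕ, p m k *
        ∫ y : Fin k → ℝ, (∏ i, (1 - F n (m + 1) (x - y i))) ∂(G m k))
    -- (B1)
    (k₀ : ℕ) (hk₀ : 1 < k₀)
    (hB1 : ∀ n k, k₀ < k → p n k = 0)
    -- (B2)
    (m₀ : ℝ) (hm₀ : 1 < m₀)
    (hB2 : ∀ n, m₀ < ∑ k ∈ Finset.Icc 1 k₀, (k : ℝ) * p n k)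
    -- (MT1)
    (ε₀ : ℝ) (hε₀pos : 0 < ε₀) (hε₀lt : ε₀ < min ((1 / 4) * Real.log m₀) 1)
    (hMT1 : ∀ n k, p n k ≠ 0 → 1 - ε₀ ≤ gbar n k 0)
    -- (MT2)
    (a M₀ : ℝ) (ha : 0 < a) (hM₀ : 0 < M₀)
    (hMT2 : ∀ n k, p n k ≠ 0 → ∀ M x : ℝ, M₀ < M → 0 ≤ x →
      gbar n k (x + M) ≤ Real.exp (-a * M) * gbar n k x)
    -- (GT)
    (hGT : ∀ η₁ : ℝ, 0 < η₁ → ∃ B : ℝ, 0 < B ∧ ∀ n k, p n k ≠ 0 →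
      1 - η₁ ≤ ((G n k) {y | ∀ i, y i ≤ B}).toReal ∧
      1 - η₁ ≤ ((G n k) {y | ∀ i, -B ≤ y i}).toReal)
    -- distribution of the maximum and its median
    (Fd : ℕ → ℝ → ℝ) (hFd : ∀ n x, Fd n x = 1 - F n 0 x)
    (hFdBot : ∀ n, Tendsto (Fd n) atBot (nhds 0))
    (hFdTop : ∀ n, Tendsto (Fd n) atTop (nhds 1))
    (Med : ℕ → ℝ) (hMed : ∀ n, Med n = sInf {x | 1 / 2 ≤ Fd n x}) :
    ∀ ε : ℝ, 0 < ε → ∃ K : ℝ, 0 < K ∧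
      ∀ n, 1 - ε ≤ Fd n (Med n + K) - Fd n (Med n - K) := by
  have hFdmono : ∀ n, Monotone (Fd n) := fun n x y hxy => by
    rw [hFd, hFd]
    linarith [hFanti n 0 (Nat.zero_le _) hxy]
  have hkR : (1 : ℝ) ≤ (k₀ : ℝ) := by exact_mod_cast hk₀.le
  have hkR0 : (0 : ℝ) < (k₀ : ℝ) := by linarith
  have hmk : m₀ ≤ k₀ := by
    have h1 := sum_one (p 0) k₀ (hp0 0) (hB1 0) (hpsum 0)
    have h2 : ∑ k ∈ Finset.Icc 1 k₀, (k : ℝ) * p 0 k ≤ ∑ k ∈ Finset.Icc 1 k₀, (k₀ : ℝ) * p 0 k := by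
      refine Finset.sum_le_sum fun k hk => mul_le_mul_of_nonneg_right ?_ (hpnonneg 0 k)
      exact_mod_cast (Finset.mem_Icc.1 hk).2
    rw [← Finset.mul_sum, h1] at h2
    linarith [hB2 0]
  -- the one-step comparison estimates
  have hstep : ∀ η : ℝ, 0 < η → ∃ B : ℝ, 0 < B ∧ ∀ n m, m < n → ∀ x,
      F n m (x + B) ≤ k₀ * F n (m + 1) x + η ∧
      1 - F n m (x - B) ≤ (1 - F n (m + 1) x)
        - ((m₀ - 1) / k₀) * ((1 - F n (m + 1) x) * F n (m + 1) x) + η := by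
    intro η hη
    obtain ⟨B, hB, h⟩ := hGT η hη
    refine ⟨B, hB, fun n m hmn x => ⟨?_, ?_⟩⟩
    · exact step_up (p m) (G m) k₀ (hGprob m) (hpnonneg m) (hp0 m) (hB1 m) (hpsum m) B η
        (fun k hk => (h m k hk).1) (F n (m + 1)) (F n m) (hFanti n (m + 1) hmn)
        (hF01 n (m + 1) hmn) (hrec n m hmn) x
    · exact step_down (p m) (G m) k₀ hk₀ (hGprob m) (hpnonneg m) (hp0 m) (hB1 m) (hpsum m) B η m₀
        (hB2 m) (fun k hk => (h m k hk).2) (F n (m + 1)) (F n m) (hFanti n (m + 1) hmn)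
        (hF01 n (m + 1) hmn) (hrec n m hmn) x
  obtain ⟨m1, ϑ, ω, η, L, s0, δ, Γ, hϑ, hϑ1, hm1, hω, hω1, hωK, hη, hL, hLϑ, hτ, hδ, hδϑ, hδs, hΓ,
    hη1, hηΓ, hs0, hsm, hEs, hmm, hLη⟩ := consts (k₀ : ℝ) m₀ hkR hm₀
  obtain ⟨B₀, hB₀, hGB⟩ := hGT η hη
  have hmb : ∀ n k, p n k ≠ 0 → (g n k).real (Ioi B₀) ≤ η ∧ (g n k).real (Iio (-B₀)) ≤ η := by
    intro n k hpk
    have hk : 0 < k := by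
      rcases Nat.eq_zero_or_pos k with h | h
      · rw [h, hp0] at hpk; exact absurd rfl hpk
      · exact h
    exact marg_bd (G n k) (g n k) (hGprob n k) ⟨0, hk⟩ (hmarg n k ⟨0, hk⟩) B₀ η
      (hGB n k hpk).1 (hGB n k hpk).2
  set B := B₀ + 1 with hBdef
  have hB : 0 < B := by linarith
  set M := 2 * B + M₀ + L / a with hMdef
  have hLa : 0 < L / a := by positivity
  have hMpos : 0 < M := by linarith
  have hMB : 2 * B ≤ M := by linarith
  have hMM : M₀ < M - B₀ - 1 := by linarith
  have hLM : L ≤ Real.exp (a * (M - B₀ - 1)) := by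
    have h1 : L / a ≤ M - B₀ - 1 := by linarith
    have h2 : L ≤ a * (M - B₀ - 1) := by
      rw [div_le_iff₀ ha] at h1
      linarith
    linarith [Real.add_one_le_exp (a * (M - B₀ - 1))]
  have hμl : ∀ n, (muAvg (p n) (g n) k₀).real (Iio (-B)) ≤ k₀ * η := by
    intro n
    rw [muAvg_real (p n) (g n) (hgprob n) (hpnonneg n)]
    have h1 := sum_one (p n) k₀ (hp0 n) (hB1 n) (hpsum n)
    calc _ ≤ ∑ k ∈ Finset.Icc 1 k₀, p n k * (k₀ * η) := by
          refine Finset.sum_le_sum fun k hk => ?_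
          by_cases hpk : p n k = 0
          · simp [hpk]
          have := hgprob n k
          have h2 : (g n k).real (Iio (-B)) ≤ (g n k).real (Iio (-B₀)) :=
            measureReal_mono (Iio_subset_Iio (by linarith))
          have h3 := h2.trans (hmb n k hpk).2
          have h4 : (k : ℝ) ≤ k₀ := by exact_mod_cast (Finset.mem_Icc.1 hk).2
          have h5 := hpnonneg n k
          calc (k : ℝ) * p n k * (g n k).real (Iio (-B)) ≤ k₀ * p n k * η := by gcongr
            _ = _ := by ring
      _ = _ := by rw [← Finset.sum_mul, h1, one_mul]
  have hμb : ∀ n, m1 ≤ (muAvg (p n) (g n) k₀).real (Icc (-B) B) := by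
    intro n
    rw [muAvg_real (p n) (g n) (hgprob n) (hpnonneg n)]
    have h1 := sum_one (p n) k₀ (hp0 n) (hB1 n) (hpsum n)
    have h2 : ∑ k ∈ Finset.Icc 1 k₀, ((k : ℝ) * p n k - p n k * (2 * (k₀ * η))) ≤
        ∑ k ∈ Finset.Icc 1 k₀, (k : ℝ) * p n k * (g n k).real (Icc (-B) B) := by
      refine Finset.sum_le_sum fun k hk => ?_
      by_cases hpk : p n k = 0
      · simp [hpk]
      have := hgprob n k
      have h3 : (g n k).real (Icc (-B) B) = 1 - (g n k).real ((Icc (-B) B)ᶜ) := by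
        rw [probReal_compl_eq_one_sub measurableSet_Icc]; ring
      have h4 : (g n k).real ((Icc (-B) B)ᶜ) ≤ (g n k).real (Ioi B₀ ∪ Iio (-B₀)) := by
        refine measureReal_mono fun y hy => ?_
        by_contra hcon
        simp only [mem_union, mem_Ioi, mem_Iio, not_or, not_lt] at hcon
        exact hy ⟨by linarith, by linarith⟩
      have h5 := measureReal_union_le (μ := g n k) (Ioi B₀) (Iio (-B₀))
      have h6 := hmb n k hpk
      have h7 : 1 - 2 * η ≤ (g n k).real (Icc (-B) B) := by linarith
      have h8 : (k : ℝ) ≤ k₀ := by exact_mod_cast (Finset.mem_Icc.1 hk).2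
      have h9 := hpnonneg n k
      have h10 : (k : ℝ) * p n k * (1 - 2 * η) ≤ (k : ℝ) * p n k * (g n k).real (Icc (-B) B) := by
        gcongr
      have h11 : (k : ℝ) * p n k * η ≤ k₀ * p n k * η := by gcongr
      linarith
    rw [Finset.sum_sub_distrib, ← Finset.sum_mul, h1] at h2
    linarith [hB2 n]
  have htail : ∀ n z, B ≤ z → L * (muAvg (p n) (g n) k₀).real (Ici z) ≤
      (muAvg (p n) (g n) k₀).real (Ioi (z - M)) := by
    intro n z hz
    rw [muAvg_real (p n) (g n) (hgprob n) (hpnonneg n), muAvg_real (p n) (g n) (hgprob n) (hpnonneg n),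
      Finset.mul_sum]
    refine Finset.sum_le_sum fun k _ => ?_
    by_cases hpk : p n k = 0
    · simp [hpk]
    have := hgprob n k
    have h1 := tail_g (g n k) a M₀ B₀ η L M ha (fun M x hM hx => by
      have := hMT2 n k hpk M x hM hx
      rw [hgbar, hgbar] at this
      exact this) (hmb n k hpk).1 (hmb n k hpk).2 hL hB₀ hLη hMM hLM z hz
    have h2 : 0 ≤ (k : ℝ) * p n k := mul_nonneg (Nat.cast_nonneg _) (hpnonneg n k)
    calc L * ((k : ℝ) * p n k * (g n k).real (Ici z))
        = (k : ℝ) * p n k * (L * (g n k).real (Ici z)) := by ring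
      _ ≤ _ := mul_le_mul_of_nonneg_left h1 h2
  -- the inductive inequality
  have hΦ' : ∀ d n m, m + d = n → ∀ x, (1 + δ) * F n m x - F n m x ^ 2 ≤ F n m (x - M) := by
    intro d
    induction d with
    | zero =>
      intro n m hmn x
      simp only [add_zero] at hmn
      subst hmn
      rcases lt_or_ge x 0 with hx | hx
      · rw [hFn1 _ _ hx, hFn1 _ _ (by linarith)]
        linarith
      · rw [hFn0 _ _ hx]
        have := (hF01 m m le_rfl (x - M)).1
        linarith
    | succ d ih =>
      intro n m hmn x
      have hlt : m < n := by omega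
      exact one_step (p m) (G m) (g m) k₀ hk₀ (hGprob m) (hgprob m) (hmarg m) (hpnonneg m) (hp0 m)
        (hB1 m) (hpsum m) m1 ϑ ω η L s0 δ B M hϑ hϑ1 hm1 hω hω1 hωK hη.le hL hLϑ hτ hδ.le hδϑ hδs
        Γ hΓ hη1 hηΓ hs0 hsm hEs hB hMB (hμb m) (hμl m) (htail m) (F n (m + 1)) (F n m)
        (hFanti n (m + 1) hlt) (hF01 n (m + 1) hlt) (hFanti n m hlt.le) (hF01 n m hlt.le)
        (hrec n m hlt) (ih n (m + 1) (by omega)) x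
  have hΦ : ∀ n m, m ≤ n → ∀ x, (1 + δ) * F n m x - F n m x ^ 2 ≤ F n m (x - M) :=
    fun n m hmn => hΦ' (n - m) n m (by omega)
  intro ε hε
  obtain ⟨K, hK, N, hN⟩ := final_tight F k₀ ((m₀ - 1) / k₀) hkR (div_pos (by linarith) hkR0)
    (by rw [div_le_one hkR0]; linarith) hF01 hFanti hFn1 hFn0 hstep δ M hδ (by linarith) hMpos hΦ
    (min (ε / 2) (1 / 4)) (lt_min (by linarith) (by norm_num))
  obtain ⟨K', hK', hN'⟩ := finite_tight Fd hFdmono hFdBot hFdTop Med ε hε N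
  refine ⟨2 * K + K', by linarith, fun n => ?_⟩
  rcases lt_or_ge n N with hn | hn
  · have h1 := hN' n hn
    have h2 := hFdmono n (by linarith : Med n + K' ≤ Med n + (2 * K + K'))
    have h3 := hFdmono n (by linarith : Med n - (2 * K + K') ≤ Med n - K')
    linarith
  · obtain ⟨x, hx1, hx2⟩ := hN n hn
    have h1 := med_tight (Fd n) (hFdmono n) (min (ε / 2) (1 / 4)) K x (Med n) (min_le_right _ _)
      (hMed n) (by rw [hFd]; linarith) (by rw [hFd]; linarith)
    have h2 := hFdmono n (by linarith : Med n + 2 * K ≤ Med n + (2 * K + K'))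
    have h3 := hFdmono n (by linarith : Med n - (2 * K + K') ≤ Med n - 2 * K)
    linarith [min_le_left (ε / 2) (1 / 4)]
end

section
/- Suppose assumption (B1) holds, suppose there exist δ₁, M, ε₁ > 0 such that for all 0 ≤ m ≤ n and all x ∈ ℝ: F̄_n^m(x) ≤ δ₁ implies F̄_n^m(x − M) ≥ (1 + ε₁/2)·F̄_n^m(x), and suppose that for every η₁ > 0 there exists B > 0 such that for all 0 ≤ m < n and all x ∈ ℝ: Q_m(F̄_n^{m+1}(x + B)) − η₁ ≤ F̄_n^m(x) ≤ Q_m(F̄_n^{m+1}(x − B)) + η₁, where Q_m(u) = ∑_{k=1}^{k₀} p_{m,k}·(1 − (1−u)^k). Then the family {F_n(· − Med(F_n))}_{n≥0} is tight: for every ε > 0 there exists K > 0 such that for all n ≥ 0, F_n(Med(F_n) + K) − F_n(Med(F_n) − K) ≥ 1 − ε. -/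
open MeasureTheory Set Filter

lemma conv_real_apply (μ ρ : Measure ℝ) [IsProbabilityMeasure μ] [IsProbabilityMeasure ρ]
    {A : Set ℝ} (hA : MeasurableSet A) :
    (μ.conv ρ).real A = ∫ y, μ.real ((fun x => x + y) ⁻¹' A) ∂ρ := by
  unfold Measure.conv
  rw [map_measureReal_apply (by fun_prop) hA, measureReal_def, 
    Measure.prod_apply_symm ((by fun_prop : Measurable fun x : ℝ × ℝ => x.1 + x.2) hA)]
  rw [← integral_toReal]
  · rfl
  · exact (measurable_measure_prodMk_right
      ((by fun_prop : Measurable fun x : ℝ × ℝ => x.1 + x.2) hA)).aemeasurable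
  · exact Eventually.of_forall fun y => measure_lt_top _ _

lemma conv_real_integrable (μ ρ : Measure ℝ) [IsProbabilityMeasure μ] [IsProbabilityMeasure ρ]
    {A : Set ℝ} (hA : MeasurableSet A) :
    Integrable (fun y => μ.real ((fun x => x + y) ⁻¹' A)) ρ := by
  have hm : Measurable fun y => μ.real ((fun x => x + y) ⁻¹' A) :=
    (measurable_measure_prodMk_right
      ((by fun_prop : Measurable fun x : ℝ × ℝ => x.1 + x.2) hA)).ennreal_toReal
  refine Integrable.of_bound hm.aestronglyMeasurable 1 (Eventually.of_forall fun y => ?_)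
  rw [Real.norm_of_nonneg measureReal_nonneg]
  exact measureReal_le_one

lemma exists_radius (μ : Measure ℝ) [IsProbabilityMeasure μ] {t : ℝ} (ht : 0 < t) :
    ∃ R : ℝ, 0 < R ∧ 1 - t ≤ μ.real (Icc (-R) R) := by
  have h : Tendsto (fun n : ℕ => μ.real (Icc (-(n : ℝ)) n)) atTop (nhds (μ.real (⋃ n : ℕ, Icc (-(n : ℝ)) n))) := by
    refine (ENNReal.tendsto_toReal (measure_ne_top _ _)).comp (tendsto_measure_iUnion_atTop ?_)
    intro a b hab
    have : (a : ℝ) ≤ b := by exact_mod_cast hab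
    exact Icc_subset_Icc (by linarith) this
  have hu : (⋃ n : ℕ, Icc (-(n : ℝ)) n) = univ := by
    refine eq_univ_of_forall fun x => ?_
    obtain ⟨n, hn⟩ := exists_nat_ge |x|
    exact mem_iUnion.2 ⟨n, abs_le.1 hn⟩
  rw [hu, probReal_univ] at h
  have h2 := h.eventually (lt_mem_nhds (show 1 - t < 1 by linarith))
  obtain ⟨n, hn, hn0⟩ := (h2.and (eventually_gt_atTop 0)).exists
  exact ⟨n, by exact_mod_cast hn0, hn.le⟩

lemma preimage_add_Icc (a b y : ℝ) : (fun x => x + y) ⁻¹' (Icc a b) = Icc (a - y) (b - y) := by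
  ext x; simp only [mem_preimage, mem_Icc]; constructor <;> rintro ⟨h1, h2⟩ <;> constructor <;> linarith

lemma levy_conc (μ : ℕ → Measure ℝ) (hμ : ∀ n, IsProbabilityMeasure (μ n))
    (hconv : ∀ m n, m ≤ n → ∃ ρ : Measure ℝ, IsProbabilityMeasure ρ ∧ μ n = (μ m).conv ρ)
    (M c : ℝ) (hc : 0 < c) (h : ∀ n, ∃ x, c ≤ (μ n).real (Icc x (x + M))) :
    ∀ τ : ℝ, 0 < τ → ∃ L : ℝ, ∀ n, ∃ x, 1 - τ ≤ (μ n).real (Icc x (x + L)) := by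
  intro τ hτ
  by_cases hτ1 : 1 ≤ τ
  · exact ⟨0, fun n => ⟨0, le_trans (by linarith) measureReal_nonneg⟩⟩
  push Not at hτ1
  set S : Set ℝ := {s | ∃ L : ℝ, ∀ n, ∃ x, s ≤ (μ n).real (Icc x (x + L))} with hS
  have hcS : c ∈ S := ⟨M, h⟩
  have hbdd : BddAbove S := ⟨1, by
    rintro s ⟨L, hL⟩
    obtain ⟨x, hx⟩ := hL 0
    exact hx.trans measureReal_le_one⟩
  set q := sSup S with hq
  have hq0 : 0 < q := lt_of_lt_of_le hc (le_csSup hbdd hcS)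
  have hq1 : q ≤ 1 := csSup_le ⟨c, hcS⟩ (by
    rintro s ⟨L, hL⟩
    obtain ⟨x, hx⟩ := hL 0
    exact hx.trans measureReal_le_one)
  set σ := τ / 8 with hσ
  have hσ0 : 0 < σ := by positivity
  obtain ⟨s, ⟨L, hL⟩, hs⟩ := exists_lt_of_lt_csSup ⟨c, hcS⟩ (show q * (1 - σ) < sSup S by
    rw [← hq]; nlinarith)
  refine ⟨L, fun m => ?_⟩
  by_contra! hcon
  have hσq : 0 < σ * q := by positivity
  obtain ⟨R, hR0, hR⟩ := exists_radius (μ m) hσq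
  have hns : q * (1 + σ) ∉ S := fun hmem => by
    have := le_csSup hbdd hmem
    rw [← hq] at this
    nlinarith
  have hns2 : ∃ n, ∀ x, (μ n).real (Icc x (x + (L + 4 * R))) < q * (1 + σ) := by
    by_contra! hh
    exact hns ⟨_, hh⟩
  obtain ⟨n0, hn0⟩ := hns2
  have hup : ∀ n, n0 ≤ n → ∀ x, (μ n).real (Icc x (x + (L + 4 * R))) ≤ q * (1 + σ) := by
    intro n hn x
    obtain ⟨ρ, hρ, he⟩ := hconv n0 n hn
    have := hμ n0
    rw [he, conv_real_apply _ _ measurableSet_Icc]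
    calc _ ≤ ∫ y, q * (1 + σ) ∂ρ := by
          refine integral_mono (conv_real_integrable _ _ measurableSet_Icc) (integrable_const _) fun y => ?_
          dsimp only
          rw [preimage_add_Icc]
          have := hn0 (x - y)
          rw [show x + (L + 4 * R) - y = x - y + (L + 4 * R) by ring]
          exact this.le
      _ = _ := by simp
  obtain ⟨ρ, hρ, he⟩ := hconv m (max m n0) (le_max_left _ _)
  obtain ⟨x, hx⟩ := hL (max m n0)
  have hmm := hμ m
  set JR : Set ℝ := Icc (x - R) (x + L + R) with hJR
  have hind : Integrable (JR.indicator (fun _ => (1 : ℝ))) ρ :=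
    (integrable_const (1:ℝ)).indicator measurableSet_Icc
  have hindv : ∫ y, JR.indicator (fun _ => (1 : ℝ)) y ∂ρ = ρ.real JR := by
    rw [integral_indicator_const _ measurableSet_Icc]; simp [hJR]
  have h1 : (μ (max m n0)).real (Icc x (x + L)) ≤ (1 - τ) * ρ.real JR + σ * q := by
    rw [he, conv_real_apply _ _ measurableSet_Icc]
    calc _ ≤ ∫ y, ((1 - τ) * JR.indicator (fun _ => (1 : ℝ)) y + σ * q) ∂ρ := by
          refine integral_mono (conv_real_integrable _ _ measurableSet_Icc)
            ((hind.const_mul _).add (integrable_const _)) fun y => ?_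
          dsimp only
          rw [preimage_add_Icc]
          by_cases hy : y ∈ JR
          · rw [indicator_of_mem hy]
            have := hcon (x - y)
            rw [show x + L - y = x - y + L by ring]
            linarith
          · rw [indicator_of_notMem hy]
            have hsub : Icc (x - y) (x + L - y) ⊆ (Icc (-R) R)ᶜ := by
              intro z hz hz2
              apply hy
              simp only [mem_Icc, hJR] at hz hz2 ⊢
              constructor <;> linarith
            have h2 := measureReal_mono (μ := μ m) hsub
            rw [probReal_compl_eq_one_sub measurableSet_Icc] at h2
            linarith
      _ = _ := by
          rw [integral_add (hind.const_mul _) (integrable_const _), integral_const_mul, hindv]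
          simp
  have h2 : (1 - σ * q) * ρ.real JR ≤ q * (1 + σ) := by
    refine le_trans ?_ (hup (max m n0) (le_max_right _ _) (x - 2 * R))
    rw [he, conv_real_apply _ _ measurableSet_Icc]
    calc _ = ∫ y, ((1 - σ * q) * JR.indicator (fun _ => (1 : ℝ)) y) ∂ρ := by
          rw [integral_const_mul, hindv]
      _ ≤ _ := by
          refine integral_mono (hind.const_mul _) (conv_real_integrable _ _ measurableSet_Icc) fun y => ?_
          dsimp only
          rw [preimage_add_Icc]
          by_cases hy : y ∈ JR
          · rw [indicator_of_mem hy, mul_one]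
            refine hR.trans (measureReal_mono ?_)
            simp only [hJR, mem_Icc] at hy
            exact Icc_subset_Icc (by linarith) (by linarith)
          · rw [indicator_of_notMem hy, mul_zero]
            exact measureReal_nonneg
  have h3 : q * (1 - σ) ≤ (1 - τ) * ρ.real JR + σ * q := hs.le.trans (hx.trans h1)
  have hr0 : 0 ≤ ρ.real JR := measureReal_nonneg
  have h4 : (1 - σ) * ρ.real JR ≤ q * (1 + σ) := by
    have : σ * q * ρ.real JR ≤ σ * 1 * ρ.real JR := by gcongr
    nlinarith
  have h5 : q * ((1 - 2 * σ) * (1 - σ)) ≤ q * ((1 - τ) * (1 + σ)) := by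
    have : (1 - τ) * ((1 - σ) * ρ.real JR) ≤ (1 - τ) * (q * (1 + σ)) :=
      mul_le_mul_of_nonneg_left h4 (by linarith)
    have h6 : (q * (1 - 2 * σ)) * (1 - σ) ≤ ((1 - τ) * ρ.real JR) * (1 - σ) :=
      mul_le_mul_of_nonneg_right (by linarith) (by linarith)
    linarith
  have h6 := le_of_mul_le_mul_left h5 hq0
  nlinarith

/-- Law of the sum of `l` independent steps started at index `m`. -/
noncomputable def walkLaw (γ : ℕ → Measure ℝ) : ℕ → ℕ → Measure ℝ
  | _, 0 => Measure.dirac 0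
  | m, l + 1 => (walkLaw γ (m + 1) l).conv (γ m)

lemma walkLaw_prob (γ : ℕ → Measure ℝ) (hγ : ∀ n, IsProbabilityMeasure (γ n)) (l : ℕ) :
    ∀ m, IsProbabilityMeasure (walkLaw γ m l) := by
  induction l with
  | zero => intro m; unfold walkLaw; infer_instance
  | succ l ih =>
    intro m
    have := ih (m + 1)
    have := hγ m
    unfold walkLaw; infer_instance

lemma walkLaw_add (γ : ℕ → Measure ℝ) (hγ : ∀ n, IsProbabilityMeasure (γ n)) (a b : ℕ) :
    ∀ m, walkLaw γ m (a + b) = (walkLaw γ m a).conv (walkLaw γ (m + a) b) := by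
  induction a with
  | zero =>
    intro m
    have := walkLaw_prob γ hγ b m
    simp [walkLaw, Measure.dirac_zero_conv]
  | succ a ih =>
    intro m
    have := walkLaw_prob γ hγ a (m + 1)
    have := walkLaw_prob γ hγ b (m + 1 + a)
    have := hγ m
    rw [show a + 1 + b = (a + b) + 1 by ring, walkLaw, walkLaw, ih (m + 1),
      show m + (a + 1) = m + 1 + a by ring, Measure.conv_assoc, Measure.conv_assoc,
      Measure.conv_comm (γ m)]

lemma walkLaw_tail (γ : ℕ → Measure ℝ) (hγ : ∀ n, IsProbabilityMeasure (γ n)) (m l : ℕ) (x : ℝ) :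
    (walkLaw γ m (l + 1)).real (Ioi x) =
      ∫ z, (walkLaw γ (m + 1) l).real (Ioi (x - z)) ∂(γ m) := by
  have := walkLaw_prob γ hγ l (m + 1)
  have := hγ m
  rw [walkLaw, conv_real_apply _ _ measurableSet_Ioi]
  congr 1; ext z; congr 1; ext w
  simp [sub_lt_iff_lt_add]

/-- One-step comparison with the random walk. -/
lemma step_compare (p : ℕ → ℝ) (G : (k : ℕ) → Measure (Fin k → ℝ)) (g : ℕ → Measure ℝ)
    (hpnonneg : ∀ k, 0 ≤ p k) (hpsum : HasSum p 1)
    (hGprob : ∀ k, IsProbabilityMeasure (G k))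
    (hmarg : ∀ k (i : Fin k), (G k).map (fun y => y i) = g k)
    (k₀ : ℕ) (hk₀ : 1 < k₀) (hB1 : ∀ k, k₀ < k → p k = 0)
    (f : ℝ → ℝ) (hf01 : ∀ x, f x ∈ Icc (0 : ℝ) 1) (hf : Antitone f) (x : ℝ) :
    |(1 - ∑' k : ℕ, p k * ∫ y : Fin k → ℝ, (∏ i, (1 - f (x - y i))) ∂(G k))
      - ∫ z, f (x - z) ∂(g 1)| ≤ 1 - p 1 := by
  set I : ℕ → ℝ := fun k => ∫ y : Fin k → ℝ, (∏ i, (1 - f (x - y i))) ∂(G k) with hI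
  have hpt : ∀ k (y : Fin k → ℝ), 0 ≤ (∏ i, (1 - f (x - y i))) ∧ (∏ i, (1 - f (x - y i))) ≤ 1 := by
    intro k y
    refine ⟨Finset.prod_nonneg fun i _ => by linarith [(hf01 (x - y i)).2],
      Finset.prod_le_one (fun i _ => by linarith [(hf01 (x - y i)).2])
        (fun i _ => by linarith [(hf01 (x - y i)).1])⟩
  have hI0 : ∀ k, 0 ≤ I k := fun k => integral_nonneg fun y => (hpt k y).1
  have hI1 : ∀ k, I k ≤ 1 := fun k => by
    have := hGprob k
    have h := norm_integral_le_of_norm_le_const (μ := G k) (C := 1)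
      (Eventually.of_forall fun y : Fin k → ℝ => by
        rw [Real.norm_of_nonneg (hpt k y).1]; exact (hpt k y).2)
    simp only [probReal_univ, mul_one] at h
    exact (le_abs_self _).trans h
  have hg : IsProbabilityMeasure (g 1) := by
    have := hGprob 1
    rw [← hmarg 1 0]
    exact Measure.isProbabilityMeasure_map (measurable_pi_apply 0).aemeasurable
  have hmeas : Measurable fun z => f (x - z) := hf.measurable.comp (by fun_prop)
  have hint : Integrable (fun z => f (x - z)) (g 1) :=
    Integrable.of_bound hmeas.aestronglyMeasurable 1 (Eventually.of_forall fun z => by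
      rw [Real.norm_of_nonneg (hf01 _).1]; exact (hf01 _).2)
  have hI1eq : I 1 = 1 - ∫ z, f (x - z) ∂(g 1) := by
    have h1 : I 1 = ∫ z, (1 - f (x - z)) ∂(g 1) := by
      rw [← hmarg 1 0, integral_map (measurable_pi_apply 0).aemeasurable]
      · simp [hI]
      · exact (measurable_const.sub hmeas).aestronglyMeasurable
    rw [h1, integral_sub (integrable_const _) hint]
    simp
  have hts : ∑' k, p k * I k = ∑ k ∈ Finset.range (k₀ + 1), p k * I k := by
    refine tsum_eq_sum fun k hk => ?_
    rw [hB1 k (by simpa using hk), zero_mul]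
  have hps : ∑ k ∈ Finset.range (k₀ + 1), p k = 1 := by
    rw [← hpsum.tsum_eq]
    refine (tsum_eq_sum fun k hk => ?_).symm
    exact hB1 k (by simpa using hk)
  have hmem : 1 ∈ Finset.range (k₀ + 1) := by simp; omega
  change |(1 - ∑' k, p k * I k) - _| ≤ _
  have e : (1 - ∑' k, p k * I k) - ∫ z, f (x - z) ∂(g 1)
      = ∑ k ∈ Finset.range (k₀ + 1), p k * (I 1 - I k) := by
    rw [hts]
    simp only [mul_sub, Finset.sum_sub_distrib, ← Finset.sum_mul, hps]
    rw [hI1eq]; ring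
  rw [e, ← Finset.add_sum_erase _ _ hmem, sub_self, mul_zero, zero_add]
  rw [← Finset.add_sum_erase _ _ hmem] at hps
  calc _ ≤ ∑ k ∈ (Finset.range (k₀ + 1)).erase 1, |p k * (I 1 - I k)| :=
        Finset.abs_sum_le_sum_abs _ _
    _ ≤ ∑ k ∈ (Finset.range (k₀ + 1)).erase 1, p k := by
        refine Finset.sum_le_sum fun k _ => ?_
        rw [abs_mul, abs_of_nonneg (hpnonneg k)]
        refine mul_le_of_le_one_right (hpnonneg k) ?_
        rw [abs_le]
        constructor <;> linarith [hI0 1, hI1 1, hI0 k, hI1 k]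
    _ = 1 - p 1 := by linarith

/-- Bounds on `Q`. -/
lemma Q_bounds (p : ℕ → ℝ) (hp0 : p 0 = 0)
    (hpnonneg : ∀ k, 0 ≤ p k) (hpsum : HasSum p 1)
    (k₀ : ℕ) (hk₀ : 1 < k₀) (hB1 : ∀ k, k₀ < k → p k = 0) (u : ℝ) (hu : u ∈ Icc (0 : ℝ) 1) :
    (∑ k ∈ Finset.Icc 1 k₀, p k * (1 - (1 - u) ^ k)) ≤ k₀ * u ∧
    1 - (1 - u) * (1 - (1 - p 1) * u) ≤ (∑ k ∈ Finset.Icc 1 k₀, p k * (1 - (1 - u) ^ k)) := by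
  obtain ⟨hu0, hu1⟩ := hu
  have hps : ∑ k ∈ Finset.Icc 1 k₀, p k = 1 := by
    rw [← hpsum.tsum_eq]
    refine (tsum_eq_sum fun k hk => ?_).symm
    rcases Nat.eq_zero_or_pos k with rfl | h
    · exact hp0
    · refine hB1 k ?_
      simp only [Finset.mem_Icc, not_and, not_le] at hk
      exact hk h
  have hmem : 1 ∈ Finset.Icc 1 k₀ := by simp; omega
  constructor
  · calc _ ≤ ∑ k ∈ Finset.Icc 1 k₀, p k * (k₀ * u) := by
          refine Finset.sum_le_sum fun k hk => mul_le_mul_of_nonneg_left ?_ (hpnonneg k)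
          have h1 := one_add_mul_le_pow (a := -u) (by linarith) k
          have hk2 : (k : ℝ) ≤ k₀ := by exact_mod_cast (Finset.mem_Icc.1 hk).2
          have : (k : ℝ) * u ≤ k₀ * u := mul_le_mul_of_nonneg_right hk2 hu0
          rw [← sub_eq_add_neg] at h1
          linarith
      _ = _ := by rw [← Finset.sum_mul, hps, one_mul]
  · have e : (∑ k ∈ Finset.Icc 1 k₀, p k * (1 - (1 - u) ^ k))
        = 1 - ∑ k ∈ Finset.Icc 1 k₀, p k * (1 - u) ^ k := by
      simp only [mul_sub, Finset.sum_sub_distrib, mul_one, hps]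
    rw [e, ← Finset.add_sum_erase _ _ hmem]
    rw [← Finset.add_sum_erase _ _ hmem] at hps
    have : ∑ k ∈ (Finset.Icc 1 k₀).erase 1, p k * (1 - u) ^ k
        ≤ ∑ k ∈ (Finset.Icc 1 k₀).erase 1, p k * (1 - u) ^ 2 := by
      refine Finset.sum_le_sum fun k hk => mul_le_mul_of_nonneg_left ?_ (hpnonneg k)
      simp only [Finset.mem_erase, Finset.mem_Icc] at hk
      exact pow_le_pow_of_le_one (by linarith) (by linarith) (by omega)
    rw [← Finset.sum_mul, show ∑ k ∈ (Finset.Icc 1 k₀).erase 1, p k = 1 - p 1 by linarith] at this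
    nlinarith

/-- Geometric decay of the right tail. -/
lemma rt_len (d M e : ℝ) (hM : 0 < M) (he : 0 < e) (a : ℝ) (ha : 0 < a) :
    ∃ K : ℝ, 0 ≤ K ∧ ∀ f : ℝ → ℝ, (∀ x, f x ∈ Icc (0 : ℝ) 1) → Antitone f →
      (∀ x, f x ≤ d → (1 + e) * f x ≤ f (x - M)) →
      ∀ x y, f x ≤ d → a ≤ f y → y - x ≤ K := by
  obtain ⟨j, hj⟩ := pow_unbounded_of_one_lt (1 / a) (show 1 < 1 + e by linarith)
  refine ⟨j * M, by positivity, fun f hf01 hf hrt x y hx hy => ?_⟩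
  by_contra! hlt
  have key : ∀ i : ℕ, i ≤ j → a * (1 + e) ^ i ≤ f (y - i * M) := by
    intro i
    induction i with
    | zero => intro _; simpa using hy
    | succ i ih =>
      intro hi
      have h1 := ih (by omega)
      have hij : (i : ℝ) ≤ j := by exact_mod_cast (by omega : i ≤ j)
      have h2 : f (y - i * M) ≤ d := (hf (by nlinarith)).trans hx
      have h3 := hrt _ h2
      rw [show y - (i : ℝ) * M - M = y - ((i + 1 : ℕ) : ℝ) * M by push_cast; ring] at h3
      refine le_trans ?_ h3
      rw [pow_succ]
      nlinarith
  have h1 := (key j le_rfl).trans (hf01 _).2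
  rw [div_lt_iff₀ ha] at hj
  linarith

lemma walk_case (f : ℕ → ℝ → ℝ) (hf01 : ∀ l x, f l x ∈ Icc (0 : ℝ) 1)
    (hf : ∀ l, Antitone (f l)) (μ : ℕ → Measure ℝ) (hμ : ∀ n, IsProbabilityMeasure (μ n))
    (hconv : ∀ m n, m ≤ n → ∃ ρ : Measure ℝ, IsProbabilityMeasure ρ ∧ μ n = (μ m).conv ρ)
    (d M e ε τ : ℝ) (hd : 0 < d) (hd2 : d ≤ 1 / 2) (hM : 0 < M) (he : 0 < e) (hε : 0 < ε)
    (hτ1 : τ ≤ d / 8) (hτ2 : τ ≤ e * d / 8) (hτ3 : τ < ε / 2)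
    (hrt : ∀ l x, f l x ≤ d → (1 + e) * f l x ≤ f l (x - M))
    (hcmp : ∀ l x, |f l x - (μ l).real (Ioi x)| ≤ τ) :
    ∃ K : ℝ, ∀ l x y, f l x ≤ 1 - ε → d ≤ f l y → y - x ≤ K := by
  have hanti : ∀ l x y, x ≤ y → (μ l).real (Ioi y) ≤ (μ l).real (Ioi x) := by
    intro l x y hxy
    have := hμ l
    exact measureReal_mono (Ioi_subset_Ioi hxy)
  -- from a concentrated interval to tails
  have htail : ∀ l x L t, 1 - t ≤ (μ l).real (Icc x (x + L)) →
      (μ l).real (Ioi (x + L)) ≤ t ∧ 1 - t ≤ (μ l).real (Ioi (x - 1)) := by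
    intro l x L t ht
    have := hμ l
    constructor
    · have hsub : Ioi (x + L) ⊆ (Icc x (x + L))ᶜ := fun z hz hz2 => by
        simp only [mem_Ioi, mem_Icc] at hz hz2; linarith
      have h2 := measureReal_mono (μ := μ l) hsub
      rw [probReal_compl_eq_one_sub measurableSet_Icc] at h2
      linarith
    · refine ht.trans (measureReal_mono fun z hz => ?_)
      simp only [mem_Ioi, mem_Icc] at hz ⊢; linarith
  have hdiff : ∀ l x y, x ≤ y →
      (μ l).real (Ioi x) - (μ l).real (Ioi y) ≤ (μ l).real (Icc x y) := by
    intro l x y hxy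
    have := hμ l
    have h1 : Ioi x ⊆ Icc x y ∪ Ioi y := fun z hz => by
      simp only [mem_Ioi, mem_union, mem_Icc] at hz ⊢
      by_cases h : z ≤ y
      · left; exact ⟨hz.le, h⟩
      · right; linarith
    have h2 := (measureReal_mono (μ := μ l) h1).trans (measureReal_union_le _ _)
    linarith
  have hconc : ∀ l, ∃ x, min (d / 4) (e * d / 8) ≤ (μ l).real (Icc x (x + (M + 1))) := by
    intro l
    have := hμ l
    obtain ⟨R, hR0, hR⟩ := exists_radius (μ l) (show 0 < d / 4 by linarith)
    have hRR := htail l (-R) (2 * R) (d / 4) (by rwa [show -R + 2 * R = R by ring])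
    set T : Set ℝ := {x | (μ l).real (Ioi x) ≤ 3 * d / 4} with hT
    have hne : T.Nonempty := ⟨-R + 2 * R, by
      simp only [hT, mem_ofPred_eq]; linarith [hRR.1]⟩
    have hbd : BddBelow T := ⟨-R - 1, fun x hx => by
      by_contra! hlt
      have := hanti l x (-R - 1) hlt.le
      simp only [hT, mem_ofPred_eq] at hx
      linarith [hRR.2]⟩
    obtain ⟨s, hs, hs1⟩ := Real.lt_sInf_add_pos hne one_pos
    have hs2 : s - 1 ∉ T := fun hmem => by
      have := csInf_le hbd hmem
      linarith
    simp only [hT, mem_ofPred_eq, not_le] at hs hs2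
    refine ⟨s - M - 1, ?_⟩
    rw [show s - M - 1 + (M + 1) = s by ring]
    have h0 := hdiff l (s - M - 1) s (by linarith)
    by_cases hcase : (μ l).real (Ioi s) ≤ d / 2
    · have h1 := hanti l (s - M - 1) (s - 1) (by linarith)
      exact (min_le_left _ _).trans (by linarith)
    · push Not at hcase
      have c1 := abs_le.1 (hcmp l s)
      have c2 := abs_le.1 (hcmp l (s - M))
      have h1 := hanti l (s - M - 1) (s - M) (by linarith)
      have h2 := hrt l s (by linarith)
      have h3 : e * (3 * d / 8) ≤ e * f l s := mul_le_mul_of_nonneg_left (by linarith) he.le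
      exact (min_le_right _ _).trans (by linarith)
  have hc0 : 0 < min (d / 4) (e * d / 8) := lt_min (by positivity) (by positivity)
  have hmin : 0 < min d ε := lt_min hd hε
  obtain ⟨L, hL⟩ := levy_conc μ hμ hconv (M + 1) _ hc0 hconc (min d ε / 2) (by linarith)
  refine ⟨L + 1, fun l x y hx hy => ?_⟩
  obtain ⟨z, hz⟩ := hL l
  obtain ⟨t1, t2⟩ := htail l z L _ hz
  have c1 := abs_le.1 (hcmp l (z + L))
  have c2 := abs_le.1 (hcmp l (z - 1))
  have m1 := min_le_left d ε
  have m2 := min_le_right d ε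
  have hy2 : y < z + L := by
    by_contra! h
    have := hf l h
    linarith
  have hx2 : z - 1 < x := by
    by_contra! h
    have := hf l h
    linarith
  linarith

/-- Uniform (in `n`) spacing of levels at generation `m`. -/
def LevelSpaced (F : ℕ → ℕ → ℝ → ℝ) (m : ℕ) (ε : ℝ) : Prop :=
  ∀ a : ℝ, 0 < a → ∃ K : ℝ, ∀ n, m ≤ n → ∀ x y, F n m x ≤ 1 - ε → a ≤ F n m y → y - x ≤ K

/-- tightness proposition: under (B1), the right-tail property with some
parameters `δ₁, M, ε₁ > 0`, and the pointwise bounds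
`Q_m(F̄_n^{m+1}(x+B)) − η₁ ≤ F̄_n^m(x) ≤ Q_m(F̄_n^{m+1}(x−B)) + η₁`, the family
`{F_n(· − Med(F_n))}` is tight. -/
theorem stmt_10
    (p : ℕ → ℕ → ℝ)
    (G : (n : ℕ) → (k : ℕ) → Measure (Fin k → ℝ))
    (g : ℕ → ℕ → Measure ℝ)
    (hp0 : ∀ n, p n 0 = 0)
    (hpnonneg : ∀ n k, 0 ≤ p n k)
    (hpsum : ∀ n, HasSum (p n) 1)
    (hpmean : ∀ n, Summable (fun k : ℕ => (k : ℝ) * p n k))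
    (hGprob : ∀ n k, IsProbabilityMeasure (G n k))
    (hgprob : ∀ n k, IsProbabilityMeasure (g n k))
    (hmarg : ∀ n k (i : Fin k), (G n k).map (fun y => y i) = g n k)
    (F : ℕ → ℕ → ℝ → ℝ)
    (hF01 : ∀ n m, m ≤ n → ∀ x, F n m x ∈ Icc (0 : ℝ) 1)
    (hFanti : ∀ n m, m ≤ n → Antitone (F n m))
    (hFrc : ∀ n m, m ≤ n → ∀ x, ContinuousWithinAt (F n m) (Ici x) x)
    (hFn1 : ∀ n (x : ℝ), x < 0 → F n n x = 1)
    (hFn0 : ∀ n (x : ℝ), 0 ≤ x → F n n x = 0)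
    (hrec : ∀ n m, m < n → ∀ x : ℝ,
      F n m x = 1 - ∑' k : ℕ, p m k *
        ∫ y : Fin k → ℝ, (∏ i, (1 - F n (m + 1) (x - y i))) ∂(G m k))
    -- (B1)
    (k₀ : ℕ) (hk₀ : 1 < k₀)
    (hB1 : ∀ n k, k₀ < k → p n k = 0)
    -- right-tail property
    (δ₁ M ε₁ : ℝ) (hδ₁ : 0 < δ₁) (hM : 0 < M) (hε₁ : 0 < ε₁)
    (hRT : ∀ n m, m ≤ n → ∀ x : ℝ,
      F n m x ≤ δ₁ → (1 + ε₁ / 2) * F n m x ≤ F n m (x - M))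
    -- pointwise bounds with Q_m(u) = ∑_{k=1}^{k₀} p_{m,k}(1 − (1−u)^k)
    (hPW : ∀ η₁ : ℝ, 0 < η₁ → ∃ B : ℝ, 0 < B ∧ ∀ n m, m < n → ∀ x : ℝ,
      (∑ k ∈ Finset.Icc 1 k₀, p m k * (1 - (1 - F n (m + 1) (x + B)) ^ k)) - η₁
        ≤ F n m x ∧
      F n m x ≤
        (∑ k ∈ Finset.Icc 1 k₀, p m k * (1 - (1 - F n (m + 1) (x - B)) ^ k)) + η₁)
    -- distribution of the maximum and its median
    (Fd : ℕ → ℝ → ℝ) (hFd : ∀ n x, Fd n x = 1 - F n 0 x)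
    (hFdBot : ∀ n, Tendsto (Fd n) atBot (nhds 0))
    (hFdTop : ∀ n, Tendsto (Fd n) atTop (nhds 1))
    (Med : ℕ → ℝ) (hMed : ∀ n, Med n = sInf {x | 1 / 2 ≤ Fd n x}) :
    ∀ ε : ℝ, 0 < ε → ∃ K : ℝ, 0 < K ∧
      ∀ n, 1 - ε ≤ Fd n (Med n + K) - Fd n (Med n - K) := by
  set d := min δ₁ (1 / 2) with hd
  set e := ε₁ / 2 with he
  have hd0 : 0 < d := lt_min hδ₁ (by norm_num)
  have hd2 : d ≤ 1 / 2 := min_le_right _ _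
  have he0 : 0 < e := by positivity
  have hrt : ∀ n m, m ≤ n → ∀ x, F n m x ≤ d → (1 + e) * F n m x ≤ F n m (x - M) :=
    fun n m hmn x hx => hRT n m hmn x (hx.trans (min_le_left _ _))
  set q : ℕ → ℝ := fun m => 1 - p m 1 with hq
  have hq0 : ∀ m, 0 ≤ q m := fun m => by
    have := le_hasSum (hpsum m) 1 (fun k _ => hpnonneg m k)
    simp only [hq]; linarith
  have hq1 : ∀ m, q m ≤ 1 := fun m => by
    simp only [hq]; linarith [hpnonneg m 1]
  -- monotonicity in ε
  have hmono : ∀ m ε ε', ε' ≤ ε → LevelSpaced F m ε' → LevelSpaced F m ε := by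
    intro m ε ε' hle h a ha
    obtain ⟨K, hK⟩ := h a ha
    exact ⟨K, fun n hn x y hx hy => hK n hn x y (by linarith) hy⟩
  -- one step
  have hstep : ∀ m ε ε', 0 < ε → ε' < ε * (1 + q m * d) →
      LevelSpaced F (m + 1) ε' → LevelSpaced F m ε := by
    intro m ε ε' hε hlt h a ha
    have hfac : 0 < 1 + q m * d := by have := hq0 m; positivity
    set η := min (a / 2) (ε - ε' / (1 + q m * d)) with hη
    have hη0 : 0 < η := lt_min (by linarith) (by
      rw [sub_pos, div_lt_iff₀ hfac]; exact hlt)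
    have hη1 : η ≤ a / 2 := min_le_left _ _
    have hη2 : ε' ≤ (ε - η) * (1 + q m * d) := by
      have : η ≤ ε - ε' / (1 + q m * d) := min_le_right _ _
      rw [← div_le_iff₀ hfac]; linarith
    obtain ⟨B, hB0, hB⟩ := hPW η hη0
    have hk0 : (0 : ℝ) < k₀ := by exact_mod_cast (by omega : 0 < k₀)
    have ha' : 0 < a / (2 * k₀) := by positivity
    obtain ⟨K1, hK1, hr⟩ := rt_len d M e hM he0 (a / (2 * k₀)) ha'
    obtain ⟨K2, hK2⟩ := h (a / (2 * k₀)) ha'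
    refine ⟨max (max K1 K2 + 2 * B) 0, fun n hn x y hx hy => ?_⟩
    rcases Nat.eq_or_lt_of_le hn with rfl | hlt'
    · by_cases hεx : x < 0
      · rw [hFn1 m x hεx] at hx; linarith
      · by_cases hy0 : y < 0
        · exact le_trans (by linarith) (le_max_right _ _)
        · rw [hFn0 m y (by linarith)] at hy; linarith
    · refine le_trans ?_ (le_max_left _ _)
      have h1 := (hB n m hlt' x).1
      have h2 := (hB n m hlt' y).2
      have hux := hF01 n (m + 1) hlt' (x + B)
      have huy := hF01 n (m + 1) hlt' (y - B)
      have b1 := (Q_bounds (p m) (hp0 m) (hpnonneg m) (hpsum m) k₀ hk₀ (hB1 m) _ hux).2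
      have b2 := (Q_bounds (p m) (hp0 m) (hpnonneg m) (hpsum m) k₀ hk₀ (hB1 m) _ huy).1
      set u := F n (m + 1) (x + B) with hu
      set v := F n (m + 1) (y - B) with hv
      have hva : a / (2 * k₀) ≤ v := by
        rw [div_le_iff₀ (by positivity)]
        nlinarith
      by_cases hud : u ≤ d
      · have := hr (F n (m + 1)) (hF01 n (m + 1) hlt') (hFanti n (m + 1) hlt')
          (hrt n (m + 1) hlt') (x + B) (y - B) hud hva
        linarith [le_max_left K1 K2]
      · push Not at hud
        have hw : ε - η ≤ (1 - u) * (1 - q m * u) := by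
          simp only [hq]; linarith
        have hw2 : (1 - u) * (1 - q m * u) ≤ (1 - u) * (1 - q m * d) := by
          refine mul_le_mul_of_nonneg_left ?_ (by linarith [hux.2])
          have := mul_le_mul_of_nonneg_left hud.le (hq0 m)
          linarith
        have hw3 : (ε - η) * (1 + q m * d) ≤ (1 - u) * (1 - q m * d) * (1 + q m * d) :=
          mul_le_mul_of_nonneg_right (hw.trans hw2) hfac.le
        have hw4 : (1 - u) * (1 - q m * d) * (1 + q m * d) ≤ 1 - u := by
          have : 0 ≤ (1 - u) * (q m * d) ^ 2 := mul_nonneg (by linarith [hux.2]) (sq_nonneg _)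
          nlinarith
        have := hK2 n hlt' (x + B) (y - B) (by linarith) hva
        linarith [le_max_right K1 K2]
  have hsteps : ∀ m ε ε', 0 < ε → ε' < ε * ∏ j ∈ Finset.range m, (1 + q j * d) →
      LevelSpaced F m ε' → LevelSpaced F 0 ε := by
    intro m
    induction m with
    | zero =>
      intro ε ε' hε hlt h
      simp only [Finset.range_zero, Finset.prod_empty, mul_one] at hlt
      exact hmono 0 ε ε' hlt.le h
    | succ m ih =>
      intro ε ε' hε hlt h
      have hfac : 0 < 1 + q m * d := by have := hq0 m; positivity
      have hprod : 0 < ∏ j ∈ Finset.range m, (1 + q j * d) :=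
        Finset.prod_pos fun j _ => by have := hq0 j; positivity
      rw [Finset.prod_range_succ, ← mul_assoc, ← div_lt_iff₀ hfac] at hlt
      obtain ⟨e', he1, he2⟩ := exists_between
        (max_lt hlt (show 0 < ε * ∏ j ∈ Finset.range m, (1 + q j * d) by positivity))
      refine ih ε e' hε he2 (hstep m e' ε' ((le_max_right _ _).trans_lt he1) ?_ h)
      rw [← div_lt_iff₀ hfac]
      exact (le_max_left _ _).trans_lt he1
  have hprodge : ∀ m, 1 + d * ∑ j ∈ Finset.range m, q j ≤
      ∏ j ∈ Finset.range m, (1 + q j * d) := by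
    intro m
    induction m with
    | zero => simp
    | succ m ih =>
      rw [Finset.prod_range_succ, Finset.sum_range_succ]
      have hs : 0 ≤ ∑ j ∈ Finset.range m, q j := Finset.sum_nonneg fun j _ => hq0 j
      have h1 : 0 ≤ q m * d := mul_nonneg (hq0 m) hd0.le
      have h2 := mul_le_mul_of_nonneg_right ih (show 0 ≤ 1 + q m * d by linarith)
      have h3 : 0 ≤ d * (∑ j ∈ Finset.range m, q j) * (q m * d) := by positivity
      nlinarith
  have hprob : ∀ m, IsProbabilityMeasure (g m 1) := fun m => hgprob m 1
  have hcmp : ∀ l m x, |F (m + l) m x - (walkLaw (fun j => g j 1) m l).real (Ioi x)|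
      ≤ ∑ j ∈ Finset.range l, q (m + j) := by
    intro l
    induction l with
    | zero =>
      intro m x
      simp only [add_zero, Finset.range_zero, Finset.sum_empty, walkLaw]
      rw [measureReal_def, Measure.dirac_apply' _ measurableSet_Ioi]
      by_cases hx : x < 0
      · rw [hFn1 m x hx, indicator_of_mem (by exact hx)]; simp
      · rw [hFn0 m x (by linarith), indicator_of_notMem (by simpa using hx)]; simp
    | succ l ih =>
      intro m x
      have hw := walkLaw_prob (fun j => g j 1) hprob l (m + 1)
      have hgp := hprob m
      have ih' := ih (m + 1)
      rw [show m + 1 + l = m + (l + 1) by ring] at ih'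
      have h01 := hF01 (m + (l + 1)) (m + 1) (by omega)
      have han := hFanti (m + (l + 1)) (m + 1) (by omega)
      have h1 := step_compare (p m) (G m) (g m) (hpnonneg m) (hpsum m) (hGprob m) (hmarg m)
        k₀ hk₀ (hB1 m) _ h01 han x
      rw [← hrec (m + (l + 1)) m (by omega) x] at h1
      rw [walkLaw_tail _ hprob]
      have hi1 : Integrable (fun z => F (m + (l + 1)) (m + 1) (x - z)) (g m 1) :=
        Integrable.of_bound (han.measurable.comp (by fun_prop)).aestronglyMeasurable 1
          (Eventually.of_forall fun z => by
            rw [Real.norm_of_nonneg (h01 _).1]; exact (h01 _).2)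
      have hHan : Antitone fun x => (walkLaw (fun j => g j 1) (m + 1) l).real (Ioi x) :=
        fun a b hab => measureReal_mono (Ioi_subset_Ioi hab)
      have hi2 : Integrable
          (fun z => (walkLaw (fun j => g j 1) (m + 1) l).real (Ioi (x - z))) (g m 1) :=
        Integrable.of_bound
          (hHan.measurable.comp (show Measurable fun z => x - z by fun_prop)).aestronglyMeasurable 1
          (Eventually.of_forall fun z => by
            rw [Real.norm_of_nonneg measureReal_nonneg]; exact measureReal_le_one)
      have h2 : |(∫ z, F (m + (l + 1)) (m + 1) (x - z) ∂(g m 1)) -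
          ∫ z, (walkLaw (fun j => g j 1) (m + 1) l).real (Ioi (x - z)) ∂(g m 1)|
          ≤ ∑ j ∈ Finset.range l, q (m + 1 + j) := by
        rw [← integral_sub hi1 hi2]
        have := norm_integral_le_of_norm_le_const (μ := g m 1)
          (Eventually.of_forall fun z => (by
            rw [Real.norm_eq_abs]; exact ih' (x - z) :
            ‖F (m + (l + 1)) (m + 1) (x - z) -
              (walkLaw (fun j => g j 1) (m + 1) l).real (Ioi (x - z))‖ ≤ _))
        simpa using this
      rw [Finset.sum_range_succ']
      have e1 : ∑ j ∈ Finset.range l, q (m + (j + 1)) = ∑ j ∈ Finset.range l, q (m + 1 + j) :=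
        Finset.sum_congr rfl fun j _ => by congr 1; ring
      rw [e1, add_zero]
      refine (abs_sub_le _ (∫ z, F (m + (l + 1)) (m + 1) (x - z) ∂(g m 1)) _).trans ?_
      rw [add_comm (∑ j ∈ Finset.range l, q (m + 1 + j))]
      exact add_le_add h1 h2
  have hmain : ∀ ε, 0 < ε → LevelSpaced F 0 ε := by
    intro ε hε
    by_cases hsum : Summable q
    · set τ := min (min (d / 8) (e * d / 8)) (ε / 8) with hτ
      have hτ0 : 0 < τ := lt_min (lt_min (by positivity) (by positivity)) (by positivity)
      have ht1 : τ ≤ d / 8 := (min_le_left _ _).trans (min_le_left _ _)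
      have ht2 : τ ≤ e * d / 8 := (min_le_left _ _).trans (min_le_right _ _)
      have ht3 : τ ≤ ε / 8 := min_le_right _ _
      obtain ⟨m, hm⟩ := ((tendsto_sum_nat_add q).eventually (gt_mem_nhds hτ0)).exists
      refine hsteps m ε (ε / 2) hε ?_ ?_
      · have hs : 0 ≤ ∑ j ∈ Finset.range m, q j := Finset.sum_nonneg fun j _ => hq0 j
        have := hprodge m
        have h3 : 0 ≤ d * ∑ j ∈ Finset.range m, q j := by positivity
        nlinarith
      · intro a ha
        obtain ⟨K1, hK1, hr⟩ := rt_len d M e hM he0 a ha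
        obtain ⟨K2, hK2⟩ := walk_case (fun l => F (m + l) m)
          (fun l => hF01 _ _ (by omega)) (fun l => hFanti _ _ (by omega))
          (walkLaw (fun j => g j 1) m) (fun l => walkLaw_prob _ hprob l m)
          (fun a b hab => ⟨walkLaw (fun j => g j 1) (m + a) (b - a),
            walkLaw_prob _ hprob _ _, by
              rw [← walkLaw_add _ hprob, Nat.add_sub_cancel' hab]⟩)
          d M e (ε / 2) τ hd0 hd2 hM he0 (by linarith) ht1 ht2 (by linarith)
          (fun l => hrt _ _ (by omega))
          (fun l x => (hcmp l m x).trans (by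
            have hsm : Summable fun j => q (m + j) := by
              simpa [add_comm] using (summable_nat_add_iff m).2 hsum
            have := hsm.sum_le_tsum (Finset.range l) (fun j _ => hq0 _)
            refine this.trans ?_
            simp only [add_comm m]
            exact hm.le))
        refine ⟨max (K2 + K1 + 1) 0, fun n hn x y hx hy => ?_⟩
        obtain ⟨l, rfl⟩ := Nat.exists_eq_add_of_le hn
        refine le_trans ?_ (le_max_left _ _)
        have hz : d ≤ F (m + l) m (y - (K1 + 1)) := by
          by_contra! hlt
          have := hr _ (hF01 _ _ hn) (hFanti _ _ hn) (hrt _ _ hn) (y - (K1 + 1)) y hlt.le hy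
          linarith
        have := hK2 l x _ hx hz
        linarith
    · have ht := (not_summable_iff_tendsto_nat_atTop_of_nonneg hq0).1 hsum
      obtain ⟨m, hm⟩ := (ht.eventually (eventually_gt_atTop (2 / (ε * d)))).exists
      refine hsteps m ε 2 hε ?_ ?_
      · have h1 := hprodge m
        rw [div_lt_iff₀ (by positivity)] at hm
        nlinarith
      · intro a ha
        refine ⟨0, fun n hn x y hx hy => ?_⟩
        have := (hF01 n m hn x).1
        linarith
  -- conclusion
  intro ε hε
  obtain ⟨K1, hK1⟩ := hmain (1 / 2) (by norm_num) (ε / 2) (by linarith)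
  obtain ⟨K2, hK2⟩ := hmain (ε / 2) (by linarith) (1 / 2) (by norm_num)
  refine ⟨max (max K1 K2) 0 + 2, by positivity, fun n => ?_⟩
  have hK1' : K1 ≤ max (max K1 K2) 0 := (le_max_left _ _).trans (le_max_left _ _)
  have hK2' : K2 ≤ max (max K1 K2) 0 := (le_max_right _ _).trans (le_max_left _ _)
  set K := max (max K1 K2) 0 with hK
  have hFdm : Monotone (Fd n) := fun a b hab => by
    rw [hFd, hFd]; linarith [hFanti n 0 (Nat.zero_le _) hab]
  have hne : {x | 1 / 2 ≤ Fd n x}.Nonempty := by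
    obtain ⟨x, hx⟩ := ((hFdTop n).eventually (lt_mem_nhds (show (1 / 2 : ℝ) < 1 by norm_num))).exists
    exact ⟨x, hx.le⟩
  have hbd : BddBelow {x | 1 / 2 ≤ Fd n x} := by
    obtain ⟨x, hx⟩ := ((hFdBot n).eventually (gt_mem_nhds (show (0 : ℝ) < 1 / 2 by norm_num))).exists
    refine ⟨x, fun y hy => ?_⟩
    by_contra! hlt
    have := hFdm hlt.le
    simp only [mem_ofPred_eq] at hy
    linarith
  have hup : F n 0 (Med n + 1) ≤ 1 / 2 := by
    obtain ⟨s, hs, hs1⟩ := Real.lt_sInf_add_pos hne one_pos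
    rw [← hMed n] at hs1
    have h1 := hFdm hs1.le
    simp only [mem_ofPred_eq] at hs
    rw [hFd n (Med n + 1)] at h1
    linarith
  have hlow : 1 / 2 ≤ F n 0 (Med n - 1) := by
    by_contra! hlt
    have hmem : Med n - 1 ∈ {x | 1 / 2 ≤ Fd n x} := by
      simp only [mem_ofPred_eq]; rw [hFd]; linarith
    have := csInf_le hbd hmem
    rw [← hMed n] at this
    linarith
  have h1 : F n 0 (Med n + (K + 2)) ≤ ε / 2 := by
    by_contra! hlt
    have := hK1 n (Nat.zero_le _) (Med n + 1) _ (by linarith) hlt.le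
    linarith
  have h2 : 1 - ε / 2 ≤ F n 0 (Med n - (K + 2)) := by
    by_contra! hlt
    have := hK2 n (Nat.zero_le _) _ (Med n - 1) hlt.le hlow
    linarith
  rw [hFd, hFd]
  linarith
end
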